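/- arXiv:math/0505385 — 2 statements merged into one kernel-verified Lean document; each statement's English description precedes it below -/
import Mathlib

section
/- There exists a constant C > 0 such that for every measurable z : ℝ³×ℝ³ → ℝ with ‖z‖_X < ∞ and every real-valued Schwartz function u on ℝ³×ℝ³, the function Θ[V[z]]u(x,v) := i (2π)^{-3/2} ∫_{ℝ³} δV[z](x,η) (F_{v→η}u)(x,η) e^{i v·η} dη satisfies ‖Θ[V[z]]u‖_X ≤ C ( ‖u‖_X + ‖∇_v u‖_X ) ‖z‖_X. -/
open MeasureTheory Real Filter ENNReal RealInnerProductSpace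

noncomputable section

abbrev E3 := EuclideanSpace ℝ (Fin 3)

/-- The weighted `X`-norm `‖w‖_X = (∫∫ |w(x,v)|² (1+|v|²)² dx dv)^{1/2}` (real valued). -/
def Xnorm (w : E3 × E3 → ℝ) : ℝ≥0∞ :=
  (∫⁻ p : E3 × E3, (‖w p‖₊ : ℝ≥0∞) ^ 2 * ENNReal.ofReal ((1 + ‖p.2‖ ^ 2) ^ 2)) ^ (1/2 : ℝ)

/-- The weighted `X`-norm for complex-valued functions. -/
def XnormC (w : E3 × E3 → ℂ) : ℝ≥0∞ :=
  (∫⁻ p : E3 × E3, (‖w p‖₊ : ℝ≥0∞) ^ 2 * ENNReal.ofReal ((1 + ‖p.2‖ ^ 2) ^ 2)) ^ (1/2 : ℝ)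

/-- The `X`-norm of `|∇_v u|`. -/
def XnormGradV (u : E3 × E3 → ℝ) : ℝ≥0∞ :=
  (∫⁻ p : E3 × E3, ENNReal.ofReal
      ((∑ i : Fin 3, (fderiv ℝ u p (0, EuclideanSpace.single i 1)) ^ 2) *
        (1 + ‖p.2‖ ^ 2) ^ 2)) ^ (1/2 : ℝ)

/-- Partial Fourier transform in the velocity variable,
`(F_{v→η}u)(x,η) = (2π)^{-3/2} ∫ u(x,v) e^{-i v·η} dv`. -/
def fourierV (u : E3 × E3 → ℝ) (x η : E3) : ℂ :=
  ((2 * π : ℝ) ^ (-(3:ℝ)/2) : ℝ) *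
    ∫ v : E3, (u (x, v) : ℂ) * Complex.exp (-(Complex.I) * ((⟪v, η⟫ : ℝ) : ℂ))

/-- The particle density `n[z](x) = ∫ z(x,v) dv`. -/
def dens (z : E3 × E3 → ℝ) (x : E3) : ℝ := ∫ v : E3, z (x, v)

/-- The potential difference `δV[z](x,η) = V[z](x+η/2) − V[z](x−η/2)` of the Newtonian
potential of `n[z]`, expressed via the dipole kernel. -/
def deltaV (z : E3 × E3 → ℝ) (x η : E3) : ℝ :=
  (4 * π)⁻¹ * ∫ y : E3,
    (‖y - (2:ℝ)⁻¹ • η‖⁻¹ - ‖y + (2:ℝ)⁻¹ • η‖⁻¹) * dens z (x - y)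

/-- The pseudo-differential operator
`Θ[V[z]]u(x,v) = i (2π)^{-3/2} ∫ δV[z](x,η) (F_{v→η}u)(x,η) e^{i v·η} dη`. -/
def Theta (z u : E3 × E3 → ℝ) (x v : E3) : ℂ :=
  Complex.I * ((2 * π : ℝ) ^ (-(3:ℝ)/2) : ℝ) *
    ∫ η : E3, (deltaV z x η : ℂ) * fourierV u x η *
      Complex.exp (Complex.I * ((⟪v, η⟫ : ℝ) : ℂ))

section

/-- The radial weight `min (|x|⁻², |x|⁻⁴)`, integrable on `ℝ³`. -/
def kappa (x : E3) : ℝ := min (‖x‖⁻¹ ^ 2) (‖x‖⁻¹ ^ 4)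

lemma kappa_nonneg (x : E3) : 0 ≤ kappa x := by unfold kappa; positivity

lemma measurable_kappa : Measurable kappa := by unfold kappa; fun_prop

lemma kappa_of_norm_le_one {x : E3} (hx : ‖x‖ ≤ 1) : kappa x = ‖x‖⁻¹ ^ 2 := by
  rcases eq_or_ne x 0 with rfl | h
  · simp [kappa]
  · have h1 : 1 ≤ ‖x‖⁻¹ := (one_le_inv₀ (norm_pos_iff.2 h)).2 hx
    exact min_eq_left (pow_le_pow_right₀ h1 (by norm_num))

lemma kappa_of_one_le_norm {x : E3} (hx : 1 ≤ ‖x‖) : kappa x = ‖x‖⁻¹ ^ 4 :=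
  min_eq_right (pow_le_pow_of_le_one (by positivity) (inv_le_one_of_one_le₀ hx) (by norm_num))

lemma integrable_of_radial_bound {f : ℝ → ℝ} (hf : Measurable f) {C : ℝ}
    (h : ∀ y, 0 < y → ‖y ^ 2 * f y‖ ≤ C * (1 + y ^ 2)⁻¹) :
    Integrable (fun x : E3 => f ‖x‖) := by
  rw [integrable_fun_norm_addHaar (volume : Measure E3)]
  simp only [finrank_euclideanSpace, Fintype.card_fin, smul_eq_mul]
  refine Integrable.mono' ((integrable_inv_one_add_sq.const_mul C).integrableOn (s := Set.Ioi 0))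
    (by fun_prop) ?_
  refine (ae_restrict_iff' measurableSet_Ioi).2 (ae_of_all _ fun y hy => ?_)
  simpa using h y hy

lemma integrable_kappa : Integrable kappa := by
  refine integrable_of_radial_bound (f := fun y => min (y⁻¹ ^ 2) (y⁻¹ ^ 4)) (by fun_prop)
    (C := 2) ?_
  intro y hy
  rw [Real.norm_of_nonneg (by positivity), ← div_eq_mul_inv, le_div_iff₀ (by positivity)]
  rcases le_total y 1 with h | h
  · calc y ^ 2 * min (y⁻¹ ^ 2) (y⁻¹ ^ 4) * (1 + y ^ 2) ≤ y ^ 2 * (y⁻¹ ^ 2) * (1 + y ^ 2) := by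
          gcongr; exact min_le_left _ _
      _ = 1 + y ^ 2 := by field_simp
      _ ≤ 2 := by nlinarith
  · calc y ^ 2 * min (y⁻¹ ^ 2) (y⁻¹ ^ 4) * (1 + y ^ 2) ≤ y ^ 2 * (y⁻¹ ^ 4) * (1 + y ^ 2) := by
          gcongr; exact min_le_right _ _
      _ = (1 + y ^ 2) / y ^ 2 := by field_simp
      _ ≤ 2 := by rw [div_le_iff₀ (by positivity)]; nlinarith

lemma integrable_one_add_sq_inv_sq : Integrable (fun x : E3 => (1 + ‖x‖ ^ 2)⁻¹ ^ 2) := by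
  refine integrable_of_radial_bound (f := fun y => (1 + y ^ 2)⁻¹ ^ 2) (by fun_prop) (C := 1) ?_
  intro y hy
  rw [Real.norm_of_nonneg (by positivity), ← div_eq_mul_inv, le_div_iff₀ (by positivity)]
  have : y ^ 2 * (1 + y ^ 2)⁻¹ ^ 2 * (1 + y ^ 2) = y ^ 2 / (1 + y ^ 2) := by field_simp
  rw [this, div_le_one (by positivity)]
  linarith

lemma integrable_inv_norm_pow_mul {f : E3 → ℂ} (hf : Integrable f) {C : ℝ} (hC : ∀ x, ‖f x‖ ≤ C)
    {n : ℕ} (hn : n ≤ 2) : Integrable (fun x => (((‖x‖⁻¹) ^ n : ℝ) : ℂ) * f x) := by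
  refine Integrable.mono' (hf.norm.add (integrable_kappa.const_mul C)) ?_ (ae_of_all _ fun x => ?_)
  · exact (by fun_prop : Measurable fun x : E3 => (((‖x‖⁻¹) ^ n : ℝ) : ℂ)).aestronglyMeasurable.mul
      hf.aestronglyMeasurable
  have hC0 : 0 ≤ C := (norm_nonneg _).trans (hC 0)
  rw [norm_mul, Complex.norm_real, Real.norm_of_nonneg (by positivity)]
  simp only [Pi.add_apply]
  rcases le_total ‖x‖ 1 with h | h
  · rw [kappa_of_norm_le_one h]
    rcases eq_or_ne x 0 with rfl | h0
    · rcases n.eq_zero_or_pos with rfl | hn'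
      · simp
      · simp [hn'.ne']
    · have h1 : 1 ≤ ‖x‖⁻¹ := (one_le_inv₀ (norm_pos_iff.2 h0)).2 h
      have := pow_le_pow_right₀ h1 hn
      have h2 : ‖x‖⁻¹ ^ n * ‖f x‖ ≤ ‖x‖⁻¹ ^ 2 * C := by gcongr; exact hC x
      linarith [norm_nonneg (f x)]
  · have : ‖x‖⁻¹ ^ n ≤ 1 := pow_le_one₀ (by positivity) (inv_le_one_of_one_le₀ h)
    have h2 : ‖x‖⁻¹ ^ n * ‖f x‖ ≤ 1 * ‖f x‖ := by gcongr
    have := mul_nonneg hC0 (kappa_nonneg x)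
    linarith

/-- The dipole kernel `1/|y - η/2| - 1/|y + η/2|`. -/
def dipole (η y : E3) : ℝ := ‖y - (2:ℝ)⁻¹ • η‖⁻¹ - ‖y + (2:ℝ)⁻¹ • η‖⁻¹

lemma measurable_dipole : Measurable (fun p : E3 × E3 => dipole p.1 p.2) := by
  unfold dipole; fun_prop

lemma sq_inv_norm_sub_inv_norm_le {p q : E3} (hp : p ≠ 0) (hq : q ≠ 0) (hpq : ‖p‖ ≤ ‖q‖) :
    (‖p‖⁻¹ - ‖q‖⁻¹) ^ 2 ≤ (4 + ‖p - q‖ ^ 2) * kappa p := by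
  have hp' := norm_pos_iff.2 hp
  have hq' := norm_pos_iff.2 hq
  have h0 : 0 ≤ ‖p‖⁻¹ - ‖q‖⁻¹ := sub_nonneg.2 (inv_anti₀ hp' hpq)
  rcases le_total ‖p‖ 1 with h | h
  · rw [kappa_of_norm_le_one h]
    have h1 : ‖p‖⁻¹ - ‖q‖⁻¹ ≤ ‖p‖⁻¹ := by linarith [inv_pos.2 hq']
    nlinarith [pow_le_pow_left₀ h0 h1 2, sq_nonneg ‖p - q‖, sq_nonneg ‖p‖⁻¹,
      mul_nonneg (sq_nonneg ‖p - q‖) (sq_nonneg ‖p‖⁻¹)]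
  · rw [kappa_of_one_le_norm h]
    have h1 : ‖p‖⁻¹ - ‖q‖⁻¹ ≤ ‖p - q‖ * ‖p‖⁻¹ ^ 2 := by
      have : ‖p‖⁻¹ - ‖q‖⁻¹ = (‖q‖ - ‖p‖) * (‖p‖⁻¹ * ‖q‖⁻¹) := by field_simp
      rw [this, pow_two]
      gcongr
      rw [norm_sub_rev]; exact norm_sub_norm_le _ _
    have h2 := pow_le_pow_left₀ h0 h1 2
    rw [mul_pow, ← pow_mul] at h2
    nlinarith [pow_nonneg (inv_nonneg.2 (norm_nonneg p)) 4]

lemma dipole_sq_le {η y : E3} (h1 : y - (2:ℝ)⁻¹ • η ≠ 0) (h2 : y + (2:ℝ)⁻¹ • η ≠ 0) :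
    dipole η y ^ 2 ≤
      (4 + ‖η‖ ^ 2) * (kappa (y - (2:ℝ)⁻¹ • η) + kappa (y + (2:ℝ)⁻¹ • η)) := by
  have hd : (y - (2:ℝ)⁻¹ • η) - (y + (2:ℝ)⁻¹ • η) = -η := by
    module
  have hn : ‖(y - (2:ℝ)⁻¹ • η) - (y + (2:ℝ)⁻¹ • η)‖ = ‖η‖ := by rw [hd, norm_neg]
  have hn' : ‖(y + (2:ℝ)⁻¹ • η) - (y - (2:ℝ)⁻¹ • η)‖ = ‖η‖ := by rw [norm_sub_rev, hn]
  have k1 := kappa_nonneg (y - (2:ℝ)⁻¹ • η)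
  have k2 := kappa_nonneg (y + (2:ℝ)⁻¹ • η)
  unfold dipole
  rcases le_total ‖y - (2:ℝ)⁻¹ • η‖ ‖y + (2:ℝ)⁻¹ • η‖ with h | h
  · have := sq_inv_norm_sub_inv_norm_le h1 h2 h
    rw [hn] at this
    nlinarith [mul_nonneg (by positivity : 0 ≤ 4 + ‖η‖ ^ 2) k2]
  · have := sq_inv_norm_sub_inv_norm_le h2 h1 h
    rw [hn', ← neg_sq, neg_sub] at this
    nlinarith [mul_nonneg (by positivity : 0 ≤ 4 + ‖η‖ ^ 2) k1]

lemma lintegral_dipole_sq_le (η : E3) :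
    ∫⁻ y, ‖dipole η y‖ₑ ^ 2 ≤
      ENNReal.ofReal (4 + ‖η‖ ^ 2) * (2 * ∫⁻ y, ENNReal.ofReal (kappa y)) := by
  have hae : ∀ a : E3, ∀ᵐ y : E3, y ≠ a := fun a => by
    simp [ae_iff]
  have hk := measurable_kappa
  calc ∫⁻ y, ‖dipole η y‖ₑ ^ 2
      ≤ ∫⁻ y, ENNReal.ofReal (4 + ‖η‖ ^ 2) * (ENNReal.ofReal (kappa (y - (2:ℝ)⁻¹ • η)) +
          ENNReal.ofReal (kappa (y + (2:ℝ)⁻¹ • η))) := by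
        refine lintegral_mono_ae ?_
        filter_upwards [hae ((2:ℝ)⁻¹ • η), hae (-((2:ℝ)⁻¹ • η))] with y h1 h2
        rw [← ENNReal.ofReal_add (kappa_nonneg _) (kappa_nonneg _),
          ← ENNReal.ofReal_mul (by positivity), ← ofReal_norm, ← ENNReal.ofReal_pow (norm_nonneg _)]
        refine ENNReal.ofReal_le_ofReal ?_
        rw [Real.norm_eq_abs, sq_abs]
        exact dipole_sq_le (sub_ne_zero.2 h1) (fun h => h2 (eq_neg_of_add_eq_zero_left h))
    _ = _ := by
        rw [lintegral_const_mul _ (by fun_prop), lintegral_add_left (by fun_prop),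
          lintegral_sub_right_eq_self (fun y => ENNReal.ofReal (kappa y)),
          lintegral_add_right_eq_self (fun y => ENNReal.ofReal (kappa y)), two_mul]

lemma lintegral_kappa_lt_top : ∫⁻ y, ENNReal.ofReal (kappa y) < ⊤ :=
  integrable_kappa.lintegral_lt_top

lemma lintegral_mul_sq_le {α : Type*} [MeasurableSpace α] {μ : Measure α} {f g : α → ℝ≥0∞}
    (hf : AEMeasurable f μ) (hg : AEMeasurable g μ) :
    (∫⁻ a, f a * g a ∂μ) ^ 2 ≤ (∫⁻ a, f a ^ 2 ∂μ) * ∫⁻ a, g a ^ 2 ∂μ := by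
  have h := ENNReal.lintegral_mul_le_Lp_mul_Lq μ Real.HolderConjugate.two_two hf hg
  have h2 := pow_le_pow_left₀ zero_le h 2
  simp only [Pi.mul_apply, ENNReal.rpow_two] at h2
  refine h2.trans_eq ?_
  rw [mul_pow, ← ENNReal.rpow_natCast, ← ENNReal.rpow_natCast, ← ENNReal.rpow_mul,
    ← ENNReal.rpow_mul]
  norm_num

open FourierTransform SchwartzMap

lemma integral_exp_neg_mul_Ioi {c : ℝ} (hc : 0 < c) :
    ∫ b in Set.Ioi (0:ℝ), rexp (-(b * c)) = c⁻¹ := by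
  have := Real.integral_rpow_mul_exp_neg_mul_Ioi (a := 1) one_pos hc
  simpa [mul_comm] using this

lemma integral_heat_Ioi {ρ : ℝ} (hρ : 0 < ρ) :
    ∫ b in Set.Ioi (0:ℝ), (π / b) ^ (3 / 2 : ℝ) * rexp (-π ^ 2 * ρ ^ 2 / b) = π / ρ := by
  have hc : 0 < π ^ 2 * ρ ^ 2 := by positivity
  have h1 := Real.integral_rpow_mul_exp_neg_mul_Ioi (a := 1 / 2) (by norm_num) hc
  have h2 := integral_comp_rpow_Ioi
    (fun t : ℝ => t ^ ((1 / 2 : ℝ) - 1) * rexp (-(π ^ 2 * ρ ^ 2 * t))) (p := -1) (by norm_num)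
  rw [h1] at h2
  have h3 : ∫ b in Set.Ioi (0:ℝ), (π / b) ^ (3 / 2 : ℝ) * rexp (-π ^ 2 * ρ ^ 2 / b) =
      π ^ (3 / 2 : ℝ) * ((1 / (π ^ 2 * ρ ^ 2)) ^ (1 / 2 : ℝ) * Real.Gamma (1 / 2)) := by
    rw [← h2, ← integral_const_mul]
    refine setIntegral_congr_fun measurableSet_Ioi fun b hb => ?_
    have hb : 0 < b := hb
    simp only [smul_eq_mul, abs_neg, abs_one, one_mul]
    rw [Real.div_rpow pi_pos.le hb.le, Real.rpow_neg_one, Real.inv_rpow hb.le,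
      ← Real.rpow_neg hb.le,
      div_eq_mul_inv, ← Real.rpow_neg hb.le, ← mul_assoc (b ^ _), ← Real.rpow_add hb, ← mul_assoc]
    norm_num
    left
    ring
  rw [h3, Real.Gamma_one_half_eq, ← Real.sqrt_eq_rpow, Real.sqrt_div zero_le_one, Real.sqrt_one,
    Real.sqrt_mul (by positivity), Real.sqrt_sq pi_pos.le, Real.sqrt_sq hρ.le,
    show (3 / 2 : ℝ) = 1 + 1 / 2 by norm_num, Real.rpow_add pi_pos, Real.rpow_one,
    ← Real.sqrt_eq_rpow]
  have := Real.mul_self_sqrt pi_pos.le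
  field_simp
  nlinarith

lemma integral_gaussian_mul_schwartz (f : 𝓢(E3, ℂ)) (x : E3) {b : ℝ} (hb : 0 < b) :
    ∫ w, (((π / b) ^ (3 / 2 : ℝ) * rexp (-π ^ 2 * ‖x - w‖ ^ 2 / b) : ℝ) : ℂ) * f w =
      ∫ k, ((rexp (-(b * ‖k‖ ^ 2)) : ℝ) : ℂ) *
        (Complex.exp (2 * π * Complex.I * (⟪x, k⟫ : ℝ)) * 𝓕 f k) := by
  have hb' : 0 < (b : ℂ).re := by simpa using hb
  have J : Integrable (fun k : E3 => Complex.exp (-b * ‖k‖ ^ 2 + 2 * π * Complex.I * ⟪x, k⟫)) :=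
    GaussianFourier.integrable_cexp_neg_mul_sq_norm_add hb' _ _
  have := (VectorFourier.integral_fourierIntegral_smul_eq_flip (L := innerₗ E3)
      Real.continuous_fourierChar continuous_inner J (f.integrable (μ := volume)))
  have h2 : ∀ w, VectorFourier.fourierIntegral Real.fourierChar volume (innerₗ E3)
      (fun k : E3 => Complex.exp (-b * ‖k‖ ^ 2 + 2 * π * Complex.I * ⟪x, k⟫)) w =
      (((π / b) ^ (3 / 2 : ℝ) * rexp (-π ^ 2 * ‖x - w‖ ^ 2 / b) : ℝ) : ℂ) := fun w => by
    refine (fourier_gaussian_innerProductSpace' hb' x w).trans ?_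
    rw [finrank_euclideanSpace, Fintype.card_fin]
    push_cast
    rw [Complex.ofReal_cpow (by positivity)]
    push_cast
    rfl
  simp only [h2, smul_eq_mul] at this
  rw [this]
  congr 1 with k
  rw [Complex.exp_add, mul_assoc]
  congr 1
  · push_cast; congr 1; ring
  · congr 1
    simp only [fourier_coe]
    congr 1
    simp

lemma norm_exp_I_mul (r : ℝ) : ‖Complex.exp (2 * π * Complex.I * r)‖ = 1 := by
  rw [show (2 * π * Complex.I * r : ℂ) = ((2 * π * r : ℝ) : ℂ) * Complex.I by push_cast; ring]
  exact Complex.norm_exp_ofReal_mul_I _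

lemma SchwartzMap.integrable_inv_norm_pow_mul (f : 𝓢(E3, ℂ)) {n : ℕ} (hn : n ≤ 2) :
    Integrable (fun x => (((‖x‖⁻¹) ^ n : ℝ) : ℂ) * f x) :=
  _root_.integrable_inv_norm_pow_mul f.integrable (f.norm_le_seminorm ℝ) hn

/-- Integrating a positive kernel against an integrable weight: Fubini with the kernel integrated
first. -/
lemma integral_integral_kernel_swap {κ : ℝ → E3 → ℝ} {K : E3 → ℝ} {g : E3 → ℂ}
    (hκ : Measurable (Function.uncurry κ)) (hκ0 : ∀ b ∈ Set.Ioi (0:ℝ), ∀ x, 0 ≤ κ b x)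
    (hK : ∀ᵐ x, K x ≠ 0 ∧ ∫ b in Set.Ioi (0:ℝ), κ b x = K x)
    (hg : AEStronglyMeasurable g) (hKg : Integrable (fun x => (K x : ℂ) * g x)) :
    ∫ b in Set.Ioi (0:ℝ), ∫ x, (κ b x : ℂ) * g x = ∫ x, (K x : ℂ) * g x := by
  have hint : ∀ᵐ x : E3, IntegrableOn (fun b => κ b x) (Set.Ioi 0) := by
    filter_upwards [hK] with x hx
    by_contra h
    exact hx.1 (by rw [← hx.2, integral_undef h])
  have hmeas : AEStronglyMeasurable (fun p : ℝ × E3 => (κ p.1 p.2 : ℂ) * g p.2)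
      ((volume.restrict (Set.Ioi 0)).prod volume) :=
    (Complex.measurable_ofReal.comp hκ).aestronglyMeasurable.mul
      (hg.comp_quasiMeasurePreserving Measure.quasiMeasurePreserving_snd)
  have hI : Integrable (fun p : ℝ × E3 => (κ p.1 p.2 : ℂ) * g p.2)
      ((volume.restrict (Set.Ioi 0)).prod volume) := by
    rw [integrable_prod_iff' hmeas]
    constructor
    · filter_upwards [hint] with x hx
      exact hx.ofReal.mul_const _
    · refine hKg.norm.congr ?_
      filter_upwards [hK] with x hx
      have h0 : 0 ≤ K x := by
        rw [← hx.2]; exact setIntegral_nonneg measurableSet_Ioi fun b hb => hκ0 b hb x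
      rw [norm_mul, Complex.norm_real, Real.norm_of_nonneg h0, ← hx.2, ← integral_mul_const]
      refine setIntegral_congr_fun measurableSet_Ioi fun b hb => ?_
      rw [norm_mul, Complex.norm_real, Real.norm_of_nonneg (hκ0 b hb x)]
  rw [integral_integral_swap hI]
  refine integral_congr_ae ?_
  filter_upwards [hK] with x hx
  rw [← hx.2, ← integral_complex_ofReal, ← integral_mul_const]

/-- The Newtonian potential of a Schwartz function in terms of its Fourier transform. -/
lemma integral_inv_norm_sub_mul_schwartz (f : 𝓢(E3, ℂ)) (x : E3) :
    π * ∫ w, ((‖w - x‖⁻¹ : ℝ) : ℂ) * f w =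
      ∫ k, ((‖k‖⁻¹ ^ 2 : ℝ) : ℂ) * (Complex.exp (2 * π * Complex.I * (⟪x, k⟫ : ℝ)) * 𝓕 f k) := by
  have hae : ∀ a : E3, ∀ᵐ y : E3, y ≠ a := fun a => by simp [ae_iff]
  have hR := integral_integral_kernel_swap (κ := fun b k => rexp (-(b * ‖k‖ ^ 2)))
    (K := fun k => ‖k‖⁻¹ ^ 2)
    (g := fun k => Complex.exp (2 * π * Complex.I * (⟪x, k⟫ : ℝ)) * 𝓕 f k)
    (by unfold Function.uncurry; fun_prop) (fun _ _ _ => by positivity)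
    (by
      filter_upwards [hae 0] with k hk
      have := norm_pos_iff.2 hk
      refine ⟨by positivity, ?_⟩
      rw [integral_exp_neg_mul_Ioi (by positivity), inv_pow])
    (by
      refine Continuous.aestronglyMeasurable ?_
      have := (𝓕 f).continuous
      fun_prop)
    (by
      refine ((𝓕 f).integrable_inv_norm_pow_mul le_rfl).norm.mono' ?_ (ae_of_all _ fun k => ?_)
      · have := (𝓕 f).continuous.measurable
        refine Measurable.aestronglyMeasurable ?_
        fun_prop
      · simp only [norm_mul, norm_exp_I_mul, one_mul]; rfl)
  have hL := integral_integral_kernel_swap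
    (κ := fun b w => (π / b) ^ (3 / 2 : ℝ) * rexp (-π ^ 2 * ‖x - w‖ ^ 2 / b))
    (K := fun w => π * ‖w - x‖⁻¹) (g := f)
    (by unfold Function.uncurry; fun_prop)
    (fun b hb _ => by have : 0 < b := hb; positivity)
    (by
      filter_upwards [hae x] with w hw
      have := norm_pos_iff.2 (sub_ne_zero.2 hw)
      refine ⟨by positivity, ?_⟩
      rw [integral_heat_Ioi (by rwa [norm_sub_rev]), norm_sub_rev, div_eq_mul_inv])
    f.continuous.aestronglyMeasurable
    (by
      have := ((f.compSubConstCLM ℝ (-x)).integrable_inv_norm_pow_mul one_le_two).comp_sub_right x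
      refine (this.const_mul (π : ℂ)).congr (ae_of_all _ fun w => ?_)
      simp [mul_assoc])
  rw [← hR]
  calc (π : ℂ) * ∫ w, ((‖w - x‖⁻¹ : ℝ) : ℂ) * f w
      = ∫ w, ((π * ‖w - x‖⁻¹ : ℝ) : ℂ) * f w := by
        rw [← integral_const_mul]; congr 1 with w; push_cast; ring
    _ = _ := by
        rw [← hL]
        exact setIntegral_congr_fun measurableSet_Ioi fun b hb =>
          integral_gaussian_mul_schwartz f x hb

lemma integrable_inv_norm_sub_mul_schwartz (f : 𝓢(E3, ℂ)) (x : E3) :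
    Integrable (fun w => ((‖w - x‖⁻¹ : ℝ) : ℂ) * f w) := by
  have := ((f.compSubConstCLM ℝ (-x)).integrable_inv_norm_pow_mul one_le_two).comp_sub_right x
  refine this.congr (ae_of_all _ fun w => ?_)
  simp

lemma integral_dipole_mul_schwartz (f : 𝓢(E3, ℂ)) (η : E3) :
    π * ∫ y, (dipole η y : ℂ) * f y =
      ∫ k, (((‖k‖⁻¹ ^ 2 : ℝ) : ℂ) * 𝓕 f k) *
        (Complex.exp (Complex.I * (⟪π • k, η⟫ : ℝ)) -
          Complex.exp (-(Complex.I * (⟪π • k, η⟫ : ℝ)))) := by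
  have h1 := integral_inv_norm_sub_mul_schwartz f ((2:ℝ)⁻¹ • η)
  have h2 := integral_inv_norm_sub_mul_schwartz f (-((2:ℝ)⁻¹ • η))
  have hi := fun x : E3 => (integrable_inv_norm_sub_mul_schwartz f x)
  have hk : ∀ x : E3, Integrable fun k => ((‖k‖⁻¹ ^ 2 : ℝ) : ℂ) *
      (Complex.exp (2 * π * Complex.I * (⟪x, k⟫ : ℝ)) * 𝓕 f k) := fun x => by
    refine ((𝓕 f).integrable_inv_norm_pow_mul le_rfl).norm.mono' ?_ (ae_of_all _ fun k => ?_)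
    · have := (𝓕 f).continuous.measurable
      refine Measurable.aestronglyMeasurable ?_
      fun_prop
    · simp only [norm_mul, norm_exp_I_mul, one_mul]; rfl
  calc π * ∫ y, (dipole η y : ℂ) * f y
      = π * ((∫ w, ((‖w - (2:ℝ)⁻¹ • η‖⁻¹ : ℝ) : ℂ) * f w) -
          ∫ w, ((‖w - -((2:ℝ)⁻¹ • η)‖⁻¹ : ℝ) : ℂ) * f w) := by
        rw [← integral_sub (hi _) (hi _)]
        congr 2 with y
        simp only [dipole, sub_neg_eq_add]
        push_cast; ring
    _ = _ := by
        rw [mul_sub, h1, h2, ← integral_sub (hk _) (hk _)]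
        congr 1 with k
        simp only [inner_neg_left, inner_smul_left, real_inner_comm k η]
        have e1 : 2 * π * Complex.I * (((starRingEnd ℝ) (2:ℝ)⁻¹ * ⟪k, η⟫ : ℝ) : ℂ) =
          Complex.I * (((starRingEnd ℝ) π * ⟪k, η⟫ : ℝ) : ℂ) := by
          simp; ring
        have e2 : 2 * π * Complex.I * ((-((starRingEnd ℝ) (2:ℝ)⁻¹ * ⟪k, η⟫) : ℝ) : ℂ) =
          -(Complex.I * (((starRingEnd ℝ) π * ⟪k, η⟫ : ℝ) : ℂ)) := by
          simp; ring
        rw [e1, e2]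
        ring

/-- The multiplier operator with symbol `∫ dipole η y * N y dy`, as an integral of differences. -/
lemma integral_multiplier_schwartz (f : 𝓢(E3, ℂ)) {Φ J : E3 → ℂ} (hΦ : Integrable Φ)
    (hJ : ∀ w, ∫ η, Φ η * Complex.exp (Complex.I * (⟪w, η⟫ : ℝ)) = J w) (v : E3) :
    π * ∫ η, (∫ y, (dipole η y : ℂ) * f y) * Φ η * Complex.exp (Complex.I * (⟪v, η⟫ : ℝ)) =
      ∫ k, (((‖k‖⁻¹ ^ 2 : ℝ) : ℂ) * 𝓕 f k) * (J (v + π • k) - J (v - π • k)) := by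
  have hG := (𝓕 f).integrable_inv_norm_pow_mul le_rfl
  have hexp : ∀ r : ℝ, ‖Complex.exp (Complex.I * r)‖ = 1 := fun r => by
    rw [mul_comm]; exact Complex.norm_exp_ofReal_mul_I r
  have hi : ∀ w, Integrable fun η => Φ η * Complex.exp (Complex.I * (⟪w, η⟫ : ℝ)) := fun w => by
    refine hΦ.norm.mono' (hΦ.aestronglyMeasurable.mul ?_) (ae_of_all _ fun η => ?_)
    · exact Continuous.aestronglyMeasurable (by fun_prop)
    · rw [norm_mul, hexp, mul_one]
  have hprod : Integrable (fun p : E3 × E3 => (Φ p.1 * (((‖p.2‖⁻¹ ^ 2 : ℝ) : ℂ) * 𝓕 f p.2)) *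
      (Complex.exp (Complex.I * (⟪v + π • p.2, p.1⟫ : ℝ)) -
        Complex.exp (Complex.I * (⟪v - π • p.2, p.1⟫ : ℝ)))) := by
    have h := hΦ.mul_prod hG
    refine (h.norm.mul_const 2).mono' (h.aestronglyMeasurable.mul ?_) (ae_of_all _ fun p => ?_)
    · exact Continuous.aestronglyMeasurable (by fun_prop)
    · rw [norm_mul]
      gcongr
      refine (norm_sub_le _ _).trans ?_
      rw [hexp, hexp]; norm_num
  calc π * ∫ η, (∫ y, (dipole η y : ℂ) * f y) * Φ η * Complex.exp (Complex.I * (⟪v, η⟫ : ℝ))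
      = ∫ η, ∫ k, (Φ η * (((‖k‖⁻¹ ^ 2 : ℝ) : ℂ) * 𝓕 f k)) *
      (Complex.exp (Complex.I * (⟪v + π • k, η⟫ : ℝ)) -
        Complex.exp (Complex.I * (⟪v - π • k, η⟫ : ℝ))) := by
        rw [← integral_const_mul]
        congr 1 with η
        rw [← mul_assoc, ← mul_assoc, integral_dipole_mul_schwartz, mul_assoc, ← integral_mul_const]
        congr 1 with k
        rw [inner_add_left, inner_sub_left]
        push_cast
        rw [mul_add, mul_sub Complex.I, Complex.exp_add,
          sub_eq_add_neg (Complex.I * _), Complex.exp_add]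
        ring
    _ = ∫ k, ∫ η, (Φ η * (((‖k‖⁻¹ ^ 2 : ℝ) : ℂ) * 𝓕 f k)) *
      (Complex.exp (Complex.I * (⟪v + π • k, η⟫ : ℝ)) -
        Complex.exp (Complex.I * (⟪v - π • k, η⟫ : ℝ))) := integral_integral_swap hprod
    _ = _ := by
        congr 1 with k
        rw [← hJ, ← hJ, ← integral_sub (hi _) (hi _), ← integral_const_mul]
        congr 1 with η
        ring

lemma fourierV_eq {u : E3 × E3 → ℝ} {x : E3} {φ : 𝓢(E3, ℂ)} (h : ∀ v, φ v = u (x, v)) (η : E3) :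
    fourierV u x η = (((2 * π : ℝ) ^ (-(3:ℝ)/2) : ℝ) : ℂ) * 𝓕 φ ((2 * π)⁻¹ • η) := by
  unfold fourierV
  congr 1
  rw [fourier_coe, Real.fourier_eq']
  congr 1 with v
  rw [h, smul_eq_mul, mul_comm, inner_smul_right]
  congr 2
  have : (π : ℂ) ≠ 0 := by exact_mod_cast pi_ne_zero
  push_cast
  field_simp

lemma integrable_fourierV {u : E3 × E3 → ℝ} {x : E3} {φ : 𝓢(E3, ℂ)} (h : ∀ v, φ v = u (x, v)) :
    Integrable (fourierV u x) := by
  rw [funext (fourierV_eq h)]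
  exact ((𝓕 φ).integrable.comp_smul (by positivity)).const_mul _

lemma integral_fourierV_mul_exp {u : E3 × E3 → ℝ} {x : E3} {φ : 𝓢(E3, ℂ)}
    (h : ∀ v, φ v = u (x, v)) (w : E3) :
    ∫ η, fourierV u x η * Complex.exp (Complex.I * (⟪w, η⟫ : ℝ)) =
      (((2 * π : ℝ) ^ ((3:ℝ)/2) : ℝ) : ℂ) * φ w := by
  have h1 := Measure.integral_comp_smul volume
    (fun ξ : E3 => 𝓕 φ ξ * Complex.exp (2 * π * Complex.I * (⟪w, ξ⟫ : ℝ))) (2 * π)⁻¹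
  have h2 : ∫ ξ : E3, 𝓕 φ ξ * Complex.exp (2 * π * Complex.I * (⟪w, ξ⟫ : ℝ)) = φ w := by
    have h3 : (𝓕⁻ (𝓕 φ)) w = φ w := by rw [FourierTransform.fourierInv_fourier_eq]
    rw [← h3, fourierInv_coe, Real.fourierInv_eq']
    congr 1 with ξ
    rw [smul_eq_mul, mul_comm, real_inner_comm]
    congr 2
    push_cast; ring
  rw [h2, finrank_euclideanSpace, Fintype.card_fin] at h1
  calc ∫ η, fourierV u x η * Complex.exp (Complex.I * (⟪w, η⟫ : ℝ))
      = (((2 * π : ℝ) ^ (-(3:ℝ)/2) : ℝ) : ℂ) * ∫ η : E3, 𝓕 φ ((2 * π)⁻¹ • η) *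
          Complex.exp (2 * π * Complex.I * (⟪w, (2 * π)⁻¹ • η⟫ : ℝ)) := by
        rw [← integral_const_mul]
        congr 1 with η
        rw [fourierV_eq h, mul_assoc, inner_smul_right]
        congr 3
        have : (π : ℂ) ≠ 0 := by exact_mod_cast pi_ne_zero
        push_cast
        field_simp
    _ = _ := by
        rw [h1, Complex.real_smul, ← mul_assoc, ← Complex.ofReal_mul]
        congr 2
        have hp : (0:ℝ) < 2 * π := by positivity
        rw [abs_of_pos (by positivity), inv_pow, inv_inv, ← Real.rpow_natCast, ← Real.rpow_add hp]
        norm_num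

/-- The velocity weight `1 + |v|²`. -/
def wt (v : E3) : ℝ≥0∞ := ENNReal.ofReal (1 + ‖v‖ ^ 2)

lemma measurable_wt : Measurable wt := by unfold wt; fun_prop

lemma wt_ne_zero (v : E3) : wt v ≠ 0 := by
  have : 0 < 1 + ‖v‖ ^ 2 := by positivity
  simpa [wt] using this

lemma wt_ne_top (v : E3) : wt v ≠ ⊤ := ENNReal.ofReal_ne_top

lemma wt_le (v a : E3) : wt v ≤ 2 * wt (v + a) + ENNReal.ofReal (2 * ‖a‖ ^ 2) := by
  have h2 (c : ℝ) : 2 * ENNReal.ofReal c = ENNReal.ofReal (2 * c) := by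
    rw [ENNReal.ofReal_mul (by norm_num)]; simp
  rw [wt, wt, h2, ← ENNReal.ofReal_add (by positivity) (by positivity)]
  refine ENNReal.ofReal_le_ofReal ?_
  have h : ‖v‖ ≤ ‖v + a‖ + ‖a‖ := by simpa using norm_sub_le (v + a) a
  nlinarith [norm_nonneg v, sq_nonneg (‖v + a‖ - ‖a‖)]

lemma wt_le_mul {v a : E3} (ha : ‖a‖ ≤ π) :
    wt v ≤ ENNReal.ofReal (2 + 2 * π ^ 2) * wt (v + a) := by
  refine (wt_le v a).trans ?_
  have h2 (c : ℝ) : 2 * ENNReal.ofReal c = ENNReal.ofReal (2 * c) := by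
    rw [ENNReal.ofReal_mul (by norm_num)]; simp
  rw [wt, h2, ← ENNReal.ofReal_add (by positivity) (by positivity),
    ← ENNReal.ofReal_mul (by positivity)]
  refine ENNReal.ofReal_le_ofReal ?_
  have : ‖a‖ ^ 2 ≤ π ^ 2 := by gcongr
  nlinarith [mul_nonneg (sq_nonneg π) (sq_nonneg ‖v + a‖)]

lemma ENNReal.add_sq_le_four (a b : ℝ≥0∞) : (a + b) ^ 2 ≤ 4 * (a ^ 2 + b ^ 2) := by
  have h : a + b ≤ 2 * max a b := by
    rw [two_mul]; exact add_le_add (le_max_left _ _) (le_max_right _ _)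
  calc (a + b) ^ 2 ≤ (2 * max a b) ^ 2 := by gcongr
    _ = 4 * (max a b) ^ 2 := by rw [mul_pow]; norm_num
    _ ≤ 4 * (a ^ 2 + b ^ 2) := by
      gcongr
      rcases max_choice a b with h | h <;> rw [h]
      · exact le_self_add
      · exact le_add_self

lemma lintegral_add_smul_le {t : ℝ} (ht : 1 ≤ |t|) {e : E3 → ℝ≥0∞} (he : Measurable e) (v : E3) :
    ∫⁻ k, e (v + t • k) ≤ ∫⁻ k, e k := by
  have ht0 : t ≠ 0 := by rintro rfl; simp at ht; linarith
  have h1 : ∫⁻ k, e (v + t • k) = ∫⁻ y, e (v + y) ∂(Measure.map (t • ·) (volume : Measure E3)) := by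
    rw [lintegral_map (by fun_prop) (by fun_prop)]
  rw [h1, Measure.map_addHaar_smul _ ht0, lintegral_smul_measure,
    lintegral_add_left_eq_self (fun y => e y)]
  refine mul_le_of_le_one_left' ?_
  rw [ENNReal.ofReal_le_one, abs_inv, abs_pow]
  exact inv_le_one_of_one_le₀ (one_le_pow₀ ht)

/-- A Young type inequality, `‖∫ h(k) e(v + t k) dk‖₂ ≤ ‖h‖₂ ‖e‖₁`. -/
lemma lintegral_sq_conv_le {t : ℝ} (ht : 1 ≤ |t|) {e h : E3 → ℝ≥0∞} (he : Measurable e)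
    (hh : Measurable h) :
    ∫⁻ v, (∫⁻ k, h k * e (v + t • k)) ^ 2 ≤ (∫⁻ k, h k ^ 2) * (∫⁻ y, e y) ^ 2 := by
  have hs : ∀ a : ℝ≥0∞, (a ^ (1 / 2 : ℝ)) ^ 2 = a := fun a => by
    rw [← ENNReal.rpow_natCast, ← ENNReal.rpow_mul]; norm_num
  calc ∫⁻ v, (∫⁻ k, h k * e (v + t • k)) ^ 2
      ≤ ∫⁻ v, (∫⁻ k, h k ^ 2 * e (v + t • k)) * ∫⁻ y, e y := by
        refine lintegral_mono fun v => ?_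
        have := lintegral_mul_sq_le (μ := (volume : Measure E3))
          (f := fun k => h k * e (v + t • k) ^ (1 / 2 : ℝ))
          (g := fun k => e (v + t • k) ^ (1 / 2 : ℝ)) (by fun_prop) (by fun_prop)
        simp only [mul_assoc, ← pow_two, mul_pow, hs] at this
        exact this.trans (mul_le_mul' le_rfl (lintegral_add_smul_le ht he v))
    _ = (∫⁻ v, ∫⁻ k, h k ^ 2 * e (v + t • k)) * ∫⁻ y, e y := by
        rw [lintegral_mul_const]
        exact Measurable.lintegral_prod_right (by fun_prop)
    _ = (∫⁻ k, h k ^ 2 * ∫⁻ y, e y) * ∫⁻ y, e y := by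
        rw [lintegral_lintegral_swap (by fun_prop)]
        congr 2 with k
        rw [lintegral_const_mul _ (by fun_prop), lintegral_add_right_eq_self (fun y => e y)]
    _ = _ := by
        rw [lintegral_mul_const _ (by fun_prop), mul_assoc, pow_two]

lemma lintegral_enorm_sq_le {w : E3 → ℝ} (hw : Measurable w) :
    (∫⁻ v, ‖w v‖ₑ) ^ 2 ≤ (∫⁻ v, (wt v)⁻¹ ^ 2) * ∫⁻ v, (wt v * ‖w v‖ₑ) ^ 2 := by
  have hm := measurable_wt
  refine le_trans (le_of_eq ?_) (lintegral_mul_sq_le (by fun_prop) (by fun_prop))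
  congr 2 with v
  rw [← mul_assoc, ENNReal.inv_mul_cancel (wt_ne_zero v) (wt_ne_top v), one_mul]

lemma lintegral_wt_inv_lt_top : ∫⁻ v, (wt v)⁻¹ ^ 2 < ⊤ := by
  refine lt_of_eq_of_lt ?_ integrable_one_add_sq_inv_sq.lintegral_lt_top
  congr 1 with v
  rw [wt, ← ENNReal.ofReal_inv_of_pos (by positivity), ENNReal.ofReal_pow (by positivity)]

lemma enorm_sub_le_lintegral_fderiv {φ : E3 → ℝ} (hφ : ContDiff ℝ 1 φ) (v k : E3) :
    ‖φ (v + π • k) - φ (v - π • k)‖ₑ ≤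
      ENNReal.ofReal (2 * π) * ‖k‖ₑ *
        ∫⁻ s in Set.Ioc (0:ℝ) 1, ‖fderiv ℝ φ (v + ((2 * s - 1) * π) • k)‖ₑ := by
  have hd : ∀ s : ℝ, HasDerivAt (fun s : ℝ => φ (v + ((2 * s - 1) * π) • k))
      (fderiv ℝ φ (v + ((2 * s - 1) * π) • k) ((2 * π) • k)) s := fun s => by
    have h1 : HasDerivAt (fun s : ℝ => v + ((2 * s - 1) * π) • k) ((2 * π) • k) s := by
      have : HasDerivAt (fun s : ℝ => (2 * s - 1) * π) (2 * π) s := by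
        simpa using (((hasDerivAt_id s).const_mul 2).sub_const 1).mul_const π
      exact (this.smul_const k).const_add v
    exact ((hφ.differentiable one_ne_zero _).hasFDerivAt).comp_hasDerivAt s h1
  have hc : Continuous fun s : ℝ => fderiv ℝ φ (v + ((2 * s - 1) * π) • k) ((2 * π) • k) := by
    have := hφ.continuous_fderiv one_ne_zero
    fun_prop
  have h := intervalIntegral.integral_eq_sub_of_hasDerivAt (a := 0) (b := 1) (fun s _ => hd s)
    (hc.intervalIntegrable _ _)
  have h2 : φ (v + π • k) - φ (v - π • k) =
      ∫ s in (0:ℝ)..1, fderiv ℝ φ (v + ((2 * s - 1) * π) • k) ((2 * π) • k) := by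
    rw [h]; norm_num [sub_eq_add_neg]
  rw [h2, intervalIntegral.integral_of_le zero_le_one, ← lintegral_const_mul' _ _ (by finiteness)]
  refine (enorm_integral_le_lintegral_enorm _).trans (lintegral_mono fun s => ?_)
  refine (ContinuousLinearMap.le_opENorm _ _).trans_eq ?_
  rw [enorm_smul, Real.enorm_of_nonneg (by positivity), mul_comm]

lemma lintegral_small_difference {φ : E3 → ℝ} (hφ : ContDiff ℝ 1 φ) {k : E3} (hk : ‖k‖ ≤ 1) :
    ∫⁻ v, (wt v * ‖φ (v + π • k) - φ (v - π • k)‖ₑ) ^ 2 ≤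
      ENNReal.ofReal ((2 + 2 * π ^ 2) * (2 * π)) ^ 2 * ‖k‖ₑ ^ 2 *
        ∫⁻ v, (wt v * ‖fderiv ℝ φ v‖ₑ) ^ 2 := by
  have hm := measurable_wt
  have hf : Measurable fun v => ‖fderiv ℝ φ v‖ₑ :=
    (hφ.continuous_fderiv one_ne_zero).enorm.measurable
  set G : E3 → ℝ≥0∞ := fun v => wt v * ‖fderiv ℝ φ v‖ₑ with hG
  have hGm : Measurable G := by fun_prop
  set c := ENNReal.ofReal ((2 + 2 * π ^ 2) * (2 * π)) with hc
  have hcs : c = ENNReal.ofReal (2 + 2 * π ^ 2) * ENNReal.ofReal (2 * π) := by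
    rw [hc, ENNReal.ofReal_mul (by positivity)]
  calc ∫⁻ v, (wt v * ‖φ (v + π • k) - φ (v - π • k)‖ₑ) ^ 2
      ≤ ∫⁻ v, c ^ 2 * ‖k‖ₑ ^ 2 *
          ∫⁻ s in Set.Ioc (0:ℝ) 1, G (v + ((2 * s - 1) * π) • k) ^ 2 := by
        refine lintegral_mono fun v => ?_
        have h1 : wt v * ‖φ (v + π • k) - φ (v - π • k)‖ₑ ≤
            c * ‖k‖ₑ * ∫⁻ s in Set.Ioc (0:ℝ) 1, G (v + ((2 * s - 1) * π) • k) := by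
          calc wt v * ‖φ (v + π • k) - φ (v - π • k)‖ₑ
              ≤ wt v * (ENNReal.ofReal (2 * π) * ‖k‖ₑ *
                ∫⁻ s in Set.Ioc (0:ℝ) 1, ‖fderiv ℝ φ (v + ((2 * s - 1) * π) • k)‖ₑ) := by
                gcongr; exact enorm_sub_le_lintegral_fderiv hφ v k
            _ = ENNReal.ofReal (2 * π) * ‖k‖ₑ *
                ∫⁻ s in Set.Ioc (0:ℝ) 1, wt v * ‖fderiv ℝ φ (v + ((2 * s - 1) * π) • k)‖ₑ := by
                rw [lintegral_const_mul' _ _ (wt_ne_top v)]; ring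
            _ ≤ ENNReal.ofReal (2 * π) * ‖k‖ₑ * ∫⁻ s in Set.Ioc (0:ℝ) 1,
                  ENNReal.ofReal (2 + 2 * π ^ 2) * G (v + ((2 * s - 1) * π) • k) := by
                refine mul_le_mul' le_rfl
                  (setLIntegral_mono' measurableSet_Ioc fun s hs => ?_)
                simp only [hG, ← mul_assoc]
                refine mul_le_mul' (wt_le_mul ?_) le_rfl
                rw [norm_smul, norm_mul, Real.norm_of_nonneg pi_pos.le, Real.norm_eq_abs]
                have : |2 * s - 1| ≤ 1 := abs_le.2 ⟨by linarith [hs.1], by linarith [hs.2]⟩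
                calc |2 * s - 1| * π * ‖k‖ ≤ 1 * π * 1 := by gcongr
                  _ = π := by ring
            _ = _ := by
                rw [lintegral_const_mul' _ _ (by finiteness), hcs]; ring
        calc _ ≤ (c * ‖k‖ₑ * ∫⁻ s in Set.Ioc (0:ℝ) 1, G (v + ((2 * s - 1) * π) • k)) ^ 2 := by
              gcongr
          _ = c ^ 2 * ‖k‖ₑ ^ 2 *
              (∫⁻ s in Set.Ioc (0:ℝ) 1, G (v + ((2 * s - 1) * π) • k) * 1) ^ 2 := by
              simp only [mul_one]; ring
          _ ≤ _ := by
              gcongr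
              refine (lintegral_mul_sq_le (by fun_prop) (by fun_prop)).trans_eq ?_
              simp
    _ = c ^ 2 * ‖k‖ₑ ^ 2 * ∫⁻ s in Set.Ioc (0:ℝ) 1, ∫⁻ v, G (v + ((2 * s - 1) * π) • k) ^ 2 := by
        rw [lintegral_const_mul _ (Measurable.lintegral_prod_right (by fun_prop)),
          lintegral_lintegral_swap (by fun_prop)]
    _ = _ := by
        congr 1
        have : ∀ s : ℝ, ∫⁻ v, G (v + ((2 * s - 1) * π) • k) ^ 2 = ∫⁻ v, G v ^ 2 := fun s =>
          lintegral_add_right_eq_self (fun v => G v ^ 2) _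
        simp only [this]
        simp [hG]

/-- The multiplier `|k|⁻²`. -/
def invSq (k : E3) : ℝ≥0∞ := ENNReal.ofReal (‖k‖⁻¹ ^ 2)

lemma measurable_invSq : Measurable invSq := by unfold invSq; fun_prop

lemma invSq_sq_mul_le {k : E3} (hk : ‖k‖ ≤ 1) :
    invSq k ^ 2 * ‖k‖ₑ ^ 2 ≤ ENNReal.ofReal (kappa k) := by
  rw [invSq, ← ofReal_norm, ← ENNReal.ofReal_pow (by positivity),
    ← ENNReal.ofReal_pow (by positivity), ← ENNReal.ofReal_mul (by positivity),
    kappa_of_norm_le_one hk]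
  refine ENNReal.ofReal_le_ofReal (le_of_eq ?_)
  rcases eq_or_ne ‖k‖ 0 with h | h
  · simp [h]
  · field_simp

lemma invSq_sq_le {k : E3} (hk : 1 ≤ ‖k‖) : invSq k ^ 2 ≤ ENNReal.ofReal (kappa k) := by
  rw [invSq, ← ENNReal.ofReal_pow (by positivity), kappa_of_one_le_norm hk]
  exact ENNReal.ofReal_le_ofReal (le_of_eq (by ring))

lemma invSq_mul_wt_le {k : E3} (hk : 1 ≤ ‖k‖) (φ : E3 → ℝ) (v : E3) :
    invSq k * (wt v * ‖φ (v + π • k) - φ (v + (-π) • k)‖ₑ) ≤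
      invSq k * (2 * (wt (v + π • k) * ‖φ (v + π • k)‖ₑ +
        wt (v + (-π) • k) * ‖φ (v + (-π) • k)‖ₑ)) +
      ENNReal.ofReal (2 * π ^ 2) * (‖φ (v + π • k)‖ₑ + ‖φ (v + (-π) • k)‖ₑ) := by
  have h1 := wt_le v (π • k)
  have h2 := wt_le v ((-π) • k)
  have hn : ∀ t : ℝ, |t| = π → invSq k * ENNReal.ofReal (2 * ‖t • k‖ ^ 2) =
      ENNReal.ofReal (2 * π ^ 2) := fun t ht => by
    rw [invSq, ← ENNReal.ofReal_mul (by positivity), norm_smul, Real.norm_eq_abs, ht]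
    congr 1
    have : ‖k‖ ≠ 0 := by linarith
    field_simp
  calc invSq k * (wt v * ‖φ (v + π • k) - φ (v + (-π) • k)‖ₑ)
      ≤ invSq k * (wt v * (‖φ (v + π • k)‖ₑ + ‖φ (v + (-π) • k)‖ₑ)) :=
        mul_le_mul' le_rfl (mul_le_mul' le_rfl enorm_sub_le)
    _ = invSq k * (wt v * ‖φ (v + π • k)‖ₑ + wt v * ‖φ (v + (-π) • k)‖ₑ) := by ring
    _ ≤ invSq k * ((2 * wt (v + π • k) + ENNReal.ofReal (2 * ‖π • k‖ ^ 2)) * ‖φ (v + π • k)‖ₑ +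
          (2 * wt (v + (-π) • k) + ENNReal.ofReal (2 * ‖(-π) • k‖ ^ 2)) *
            ‖φ (v + (-π) • k)‖ₑ) :=
        mul_le_mul' le_rfl (add_le_add (mul_le_mul' h1 le_rfl) (mul_le_mul' h2 le_rfl))
    _ = invSq k * (2 * (wt (v + π • k) * ‖φ (v + π • k)‖ₑ +
        wt (v + (-π) • k) * ‖φ (v + (-π) • k)‖ₑ)) +
        (invSq k * ENNReal.ofReal (2 * ‖π • k‖ ^ 2) * ‖φ (v + π • k)‖ₑ +
          invSq k * ENNReal.ofReal (2 * ‖(-π) • k‖ ^ 2) * ‖φ (v + (-π) • k)‖ₑ) := by ring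
    _ = _ := by
        rw [hn π (abs_of_pos pi_pos), hn (-π) (by rw [abs_neg, abs_of_pos pi_pos])]
        ring

/-- Majorant for the weighted difference: the difference itself at low frequency, a sum of
translates at high frequency. -/
def diffMajorant (φ : E3 → ℝ) (v k : E3) : ℝ≥0∞ :=
  {k : E3 | ‖k‖ ≤ 1}.indicator (fun k => wt v * ‖φ (v + π • k) - φ (v + (-π) • k)‖ₑ) k +
  {k : E3 | ‖k‖ ≤ 1}ᶜ.indicator (fun k => 2 * (wt (v + π • k) * ‖φ (v + π • k)‖ₑ +
        wt (v + (-π) • k) * ‖φ (v + (-π) • k)‖ₑ)) k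

lemma diffMajorant_of_le (φ : E3 → ℝ) (v : E3) {k : E3} (hk : ‖k‖ ≤ 1) :
    diffMajorant φ v k = wt v * ‖φ (v + π • k) - φ (v + (-π) • k)‖ₑ := by
  simp [diffMajorant, hk]

lemma diffMajorant_of_lt (φ : E3 → ℝ) (v : E3) {k : E3} (hk : 1 < ‖k‖) :
    diffMajorant φ v k = 2 * (wt (v + π • k) * ‖φ (v + π • k)‖ₑ +
        wt (v + (-π) • k) * ‖φ (v + (-π) • k)‖ₑ) := by
  simp [diffMajorant, hk]

lemma measurable_diffMajorant {φ : E3 → ℝ} (hφ : Measurable φ) :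
    Measurable (Function.uncurry (diffMajorant φ)) := by
  have hm := measurable_wt
  have hs : MeasurableSet {p : E3 × E3 | ‖p.2‖ ≤ 1} :=
    measurableSet_le (by fun_prop) (by fun_prop)
  have h1 : Measurable fun p : E3 × E3 =>
      wt p.1 * ‖φ (p.1 + π • p.2) - φ (p.1 + (-π) • p.2)‖ₑ := by fun_prop
  have h2 : Measurable fun p : E3 × E3 => 2 * (wt (p.1 + π • p.2) * ‖φ (p.1 + π • p.2)‖ₑ +
        wt (p.1 + (-π) • p.2) * ‖φ (p.1 + (-π) • p.2)‖ₑ) := by fun_prop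
  exact (h1.indicator hs).add (h2.indicator hs.compl)

lemma lintegral_diffMajorant_le {φ : E3 → ℝ} (hφ : ContDiff ℝ 1 φ) (k : E3) :
    ∫⁻ v, (invSq k * diffMajorant φ v k) ^ 2 ≤
      (ENNReal.ofReal ((2 + 2 * π ^ 2) * (2 * π)) ^ 2 + 32) * ENNReal.ofReal (kappa k) *
        ((∫⁻ v, (wt v * ‖φ v‖ₑ) ^ 2) + ∫⁻ v, (wt v * ‖fderiv ℝ φ v‖ₑ) ^ 2) := by
  have hm := measurable_wt
  have hφm : Measurable φ := hφ.continuous.measurable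
  have hr : invSq k ^ 2 ≠ ⊤ := by simp [invSq]
  set c := ENNReal.ofReal ((2 + 2 * π ^ 2) * (2 * π))
  set P := ∫⁻ v, (wt v * ‖φ v‖ₑ) ^ 2 with hP
  set Q := ∫⁻ v, (wt v * ‖fderiv ℝ φ v‖ₑ) ^ 2
  simp only [mul_pow (invSq k)]
  rw [lintegral_const_mul' _ _ hr]
  rcases le_or_gt ‖k‖ 1 with hk | hk
  · simp only [diffMajorant_of_le φ _ hk, neg_smul, ← sub_eq_add_neg]
    calc _ ≤ invSq k ^ 2 * (c ^ 2 * ‖k‖ₑ ^ 2 * Q) :=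
          mul_le_mul' le_rfl (lintegral_small_difference hφ hk)
      _ = c ^ 2 * (invSq k ^ 2 * ‖k‖ₑ ^ 2) * Q := by ring
      _ ≤ (c ^ 2 + 32) * ENNReal.ofReal (kappa k) * (P + Q) :=
          mul_le_mul' (mul_le_mul' le_self_add (invSq_sq_mul_le hk)) le_add_self
  · simp only [diffMajorant_of_lt φ _ hk]
    have ht : ∀ a : E3, ∫⁻ v, (wt (v + a) * ‖φ (v + a)‖ₑ) ^ 2 = P := fun a =>
      lintegral_add_right_eq_self (fun v => (wt v * ‖φ v‖ₑ) ^ 2) a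
    have h32 : ∫⁻ v, (2 * (wt (v + π • k) * ‖φ (v + π • k)‖ₑ +
        wt (v + (-π) • k) * ‖φ (v + (-π) • k)‖ₑ)) ^ 2 ≤ 32 * P := by
      calc _ ≤ ∫⁻ v, 16 * ((wt (v + π • k) * ‖φ (v + π • k)‖ₑ) ^ 2 +
            (wt (v + (-π) • k) * ‖φ (v + (-π) • k)‖ₑ) ^ 2) := by
            refine lintegral_mono fun v => ?_
            rw [mul_pow]
            refine (mul_le_mul' le_rfl (ENNReal.add_sq_le_four _ _)).trans_eq ?_
            ring
        _ = 16 * (P + P) := by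
            rw [lintegral_const_mul _ (by fun_prop), lintegral_add_left (by fun_prop), ht, ht]
        _ = 32 * P := by ring
    calc _ ≤ invSq k ^ 2 * (32 * P) := mul_le_mul' le_rfl h32
      _ = 32 * invSq k ^ 2 * P := by ring
      _ ≤ _ := mul_le_mul' (mul_le_mul' le_add_self (invSq_sq_le hk.le)) le_self_add

/-- Boundedness on `L²` of the operator with kernel
`(1 + |v|²) |k|⁻² (φ(v + πk) - φ(v - πk))`. -/
lemma exists_lintegral_weighted_difference_le :
    ∃ K : ℝ≥0∞, K ≠ ⊤ ∧ ∀ φ : E3 → ℝ, ContDiff ℝ 1 φ → ∀ h : E3 → ℝ≥0∞, Measurable h →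
      ∫⁻ v, (∫⁻ k, h k * (invSq k * (wt v * ‖φ (v + π • k) - φ (v + (-π) • k)‖ₑ))) ^ 2 ≤
        K * (∫⁻ k, h k ^ 2) *
          ((∫⁻ v, (wt v * ‖φ v‖ₑ) ^ 2) + ∫⁻ v, (wt v * ‖fderiv ℝ φ v‖ₑ) ^ 2) := by
  set c := ENNReal.ofReal ((2 + 2 * π ^ 2) * (2 * π))
  set d := ENNReal.ofReal (2 * π ^ 2)
  set κ := ∫⁻ k, ENNReal.ofReal (kappa k) with hκ
  set W := ∫⁻ v, (wt v)⁻¹ ^ 2 with hW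
  have hκt : κ ≠ ⊤ := lintegral_kappa_lt_top.ne
  have hWt : W ≠ ⊤ := lintegral_wt_inv_lt_top.ne
  have hdt : d ≠ ⊤ := ENNReal.ofReal_ne_top
  have hct : c ≠ ⊤ := ENNReal.ofReal_ne_top
  refine ⟨4 * ((c ^ 2 + 32) * κ + 8 * d ^ 2 * W), by finiteness, fun φ hφ h hh => ?_⟩
  have hm := measurable_wt
  have hr := measurable_invSq
  have hκm := measurable_kappa
  have hφm : Measurable φ := hφ.continuous.measurable
  set P := ∫⁻ v, (wt v * ‖φ v‖ₑ) ^ 2 with hP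
  set Q := ∫⁻ v, (wt v * ‖fderiv ℝ φ v‖ₑ) ^ 2
  set H := ∫⁻ k, h k ^ 2
  have hM := measurable_diffMajorant hφm
  have hMv : ∀ v, Measurable (diffMajorant φ v) := fun v => hM.of_uncurry_left
  set S : E3 → ℝ≥0∞ := fun v => ∫⁻ k, h k * (invSq k * diffMajorant φ v k) with hS
  set T : ℝ → E3 → ℝ≥0∞ := fun t v => ∫⁻ k, h k * ‖φ (v + t • k)‖ₑ with hT
  have hTm : ∀ t, Measurable (T t) := fun t => by
    have hu : Measurable fun p : E3 × E3 => h p.2 * ‖φ (p.1 + t • p.2)‖ₑ := by fun_prop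
    exact hu.lintegral_prod_right'
  have hpt : ∀ v, (∫⁻ k, h k * (invSq k *
      (wt v * ‖φ (v + π • k) - φ (v + (-π) • k)‖ₑ))) ≤ S v + d * (T π v + T (-π) v) := by
    intro v
    have h1 : S v + d * (T π v + T (-π) v) = ∫⁻ k, h k * (invSq k * diffMajorant φ v k +
        d * (‖φ (v + π • k)‖ₑ + ‖φ (v + (-π) • k)‖ₑ)) := by
      simp only [hS, hT, mul_add]
      rw [lintegral_add_left (by fun_prop), lintegral_add_left (by fun_prop),
        ← lintegral_const_mul' _ _ hdt, ← lintegral_const_mul' _ _ hdt]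
      simp only [mul_left_comm]
    rw [h1]
    refine lintegral_mono fun k => mul_le_mul' le_rfl ?_
    rcases le_or_gt ‖k‖ 1 with hk | hk
    · rw [diffMajorant_of_le φ v hk]; exact le_self_add
    · rw [diffMajorant_of_lt φ v hk]; exact invSq_mul_wt_le hk.le φ v
  have hSb : ∫⁻ v, S v ^ 2 ≤ (c ^ 2 + 32) * κ * H * (P + Q) := by
    have hu : Measurable (Function.uncurry fun v k => (invSq k * diffMajorant φ v k) ^ 2) := by
      have : Measurable fun p : E3 × E3 => invSq p.2 := by fun_prop
      exact (this.mul hM).pow_const 2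
    calc ∫⁻ v, S v ^ 2 ≤ ∫⁻ v, H * ∫⁻ k, (invSq k * diffMajorant φ v k) ^ 2 :=
          lintegral_mono fun v => lintegral_mul_sq_le (by fun_prop) (by fun_prop)
      _ = H * ∫⁻ v, ∫⁻ k, (invSq k * diffMajorant φ v k) ^ 2 :=
          lintegral_const_mul _ (Measurable.lintegral_prod_right hu)
      _ = H * ∫⁻ k, ∫⁻ v, (invSq k * diffMajorant φ v k) ^ 2 := by
          rw [lintegral_lintegral_swap hu.aemeasurable]
      _ ≤ H * ∫⁻ k, (c ^ 2 + 32) * ENNReal.ofReal (kappa k) * (P + Q) :=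
          mul_le_mul' le_rfl (lintegral_mono fun k => lintegral_diffMajorant_le hφ k)
      _ = (c ^ 2 + 32) * κ * H * (P + Q) := by
          rw [lintegral_mul_const _ (by fun_prop), lintegral_const_mul _ (by fun_prop)]
          ring
  have hTb : ∀ t : ℝ, 1 ≤ |t| → ∫⁻ v, T t v ^ 2 ≤ H * (W * P) := fun t ht =>
    (lintegral_sq_conv_le ht hφm.enorm hh).trans
      (mul_le_mul' le_rfl (lintegral_enorm_sq_le hφm))
  have hpi : (1:ℝ) ≤ |π| := by rw [abs_of_pos pi_pos]; linarith [pi_gt_three]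
  calc _ ≤ ∫⁻ v, (S v + d * (T π v + T (-π) v)) ^ 2 :=
        lintegral_mono fun v => pow_le_pow_left' (hpt v) 2
    _ ≤ ∫⁻ v, 4 * (S v ^ 2 + d ^ 2 * (4 * (T π v ^ 2 + T (-π) v ^ 2))) := by
        refine lintegral_mono fun v => (ENNReal.add_sq_le_four _ _).trans ?_
        rw [mul_pow]
        exact mul_le_mul' le_rfl (add_le_add le_rfl
          (mul_le_mul' le_rfl (ENNReal.add_sq_le_four _ _)))
    _ = 4 * ((∫⁻ v, S v ^ 2) + d ^ 2 * (4 * ((∫⁻ v, T π v ^ 2) + ∫⁻ v, T (-π) v ^ 2))) := by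
        have := hTm π
        have := hTm (-π)
        rw [lintegral_const_mul' _ _ (by finiteness), lintegral_add_right _ (by fun_prop),
          lintegral_const_mul' _ _ (by finiteness), lintegral_const_mul' _ _ (by finiteness),
          lintegral_add_left (by fun_prop)]
    _ ≤ 4 * ((c ^ 2 + 32) * κ * H * (P + Q) + d ^ 2 * (4 * (H * (W * P) + H * (W * P)))) := by
        refine mul_le_mul' le_rfl (add_le_add hSb (mul_le_mul' le_rfl (mul_le_mul' le_rfl
          (add_le_add (hTb π hpi) (hTb (-π) (by rwa [abs_neg]))))))
    _ = 4 * ((c ^ 2 + 32) * κ * H * (P + Q) + 8 * d ^ 2 * W * H * P) := by ring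
    _ ≤ 4 * ((c ^ 2 + 32) * κ * H * (P + Q) + 8 * d ^ 2 * W * H * (P + Q)) :=
        mul_le_mul' le_rfl (add_le_add le_rfl (mul_le_mul' le_rfl le_self_add))
    _ = _ := by ring

lemma eLpNorm_two_sq {N : E3 → ℂ} : eLpNorm N 2 volume ^ 2 = ∫⁻ y, ‖N y‖ₑ ^ 2 := by
  have := eLpNorm_nnreal_pow_eq_lintegral (f := N) (μ := volume) (p := 2) two_ne_zero
  simpa using this

lemma SchwartzMap.lintegral_enorm_sq (f : 𝓢(E3, ℂ)) :
    ∫⁻ x, ‖f x‖ₑ ^ 2 = ENNReal.ofReal (∫ x, ‖f x‖ ^ 2) := by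
  have hi : Integrable (fun x => ‖f x‖ ^ 2) volume :=
    (memLp_two_iff_integrable_sq_norm f.continuous.aestronglyMeasurable).1 (f.memLp 2)
  rw [ofReal_integral_eq_lintegral_ofReal hi (ae_of_all _ fun x => by positivity)]
  simp only [← ofReal_norm, ENNReal.ofReal_pow (norm_nonneg _)]

lemma SchwartzMap.lintegral_fourier_sq (f : 𝓢(E3, ℂ)) :
    ∫⁻ k, ‖𝓕 f k‖ₑ ^ 2 = ∫⁻ y, ‖f y‖ₑ ^ 2 := by
  rw [SchwartzMap.lintegral_enorm_sq, SchwartzMap.lintegral_enorm_sq, integral_norm_sq_fourier]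

/-- The symbol `η ↦ ∫ (1/|y - η/2| - 1/|y + η/2|) N(y) dy`. -/
def dipoleSymbol (N : E3 → ℂ) (η : E3) : ℂ := ∫ y, (dipole η y : ℂ) * N y

/-- The constant in the bound of the dipole symbol by the `L²` norm of the density. -/
def dipoleConst : ℝ≥0∞ := 1 + 2 * ∫⁻ y : E3, ENNReal.ofReal (kappa y)

lemma dipoleConst_ne_top : dipoleConst ≠ ⊤ := by
  have := lintegral_kappa_lt_top.ne
  unfold dipoleConst
  finiteness

lemma aestronglyMeasurable_dipole_mul {N : E3 → ℂ} (hN : AEStronglyMeasurable N) (η : E3) :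
    AEStronglyMeasurable (fun y => (dipole η y : ℂ) * N y) := by
  have h : Measurable (dipole η) := measurable_dipole.of_uncurry_left
  exact (Complex.measurable_ofReal.comp h).aestronglyMeasurable.mul hN

lemma lintegral_enorm_dipole_mul_le {N : E3 → ℂ} (hN : AEStronglyMeasurable N) (η : E3) :
    ∫⁻ y, ‖(dipole η y : ℂ) * N y‖ₑ ≤
      ENNReal.ofReal (2 + ‖η‖) * dipoleConst * eLpNorm N 2 volume := by
  have h : Measurable (dipole η) := measurable_dipole.of_uncurry_left
  refine (ENNReal.pow_le_pow_left_iff two_ne_zero).1 ?_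
  simp only [enorm_mul]
  have hm : Measurable fun y => ‖(dipole η y : ℂ)‖ₑ := (Complex.measurable_ofReal.comp h).enorm
  refine (lintegral_mul_sq_le hm.aemeasurable hN.enorm).trans ?_
  rw [mul_pow, eLpNorm_two_sq]
  refine mul_le_mul' ?_ le_rfl
  have hE : ∀ r : ℝ, ‖(r : ℂ)‖ₑ = ‖r‖ₑ := fun r => by
    rw [← ofReal_norm, ← ofReal_norm, Complex.norm_real]
  simp only [hE]
  refine (lintegral_dipole_sq_le η).trans ?_
  rw [mul_pow, ← ENNReal.ofReal_pow (by positivity)]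
  refine mul_le_mul' (ENNReal.ofReal_le_ofReal (by nlinarith [norm_nonneg η])) ?_
  rw [pow_two]
  exact le_add_self.trans (le_mul_of_one_le_left' le_self_add)

lemma integrable_dipole_mul {N : E3 → ℂ} (hN : MemLp N 2) (η : E3) :
    Integrable (fun y => (dipole η y : ℂ) * N y) := by
  refine ⟨aestronglyMeasurable_dipole_mul hN.1 η,
    (lintegral_enorm_dipole_mul_le hN.1 η).trans_lt ?_⟩
  have := dipoleConst_ne_top
  have := hN.eLpNorm_ne_top
  finiteness

lemma enorm_dipoleSymbol_le {N : E3 → ℂ} (hN : AEStronglyMeasurable N) (η : E3) :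
    ‖dipoleSymbol N η‖ₑ ≤ ENNReal.ofReal (2 + ‖η‖) * dipoleConst * eLpNorm N 2 volume :=
  (enorm_integral_le_lintegral_enorm _).trans (lintegral_enorm_dipole_mul_le hN η)

lemma dipoleSymbol_sub {N f : E3 → ℂ} (hN : MemLp N 2) (hf : MemLp f 2) (η : E3) :
    dipoleSymbol (N - f) η = dipoleSymbol N η - dipoleSymbol f η := by
  unfold dipoleSymbol
  rw [← integral_sub (integrable_dipole_mul hN η) (integrable_dipole_mul hf η)]
  simp only [Pi.sub_apply, mul_sub]

lemma aestronglyMeasurable_dipoleSymbol {N : E3 → ℂ} (hN : AEStronglyMeasurable N) :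
    AEStronglyMeasurable (dipoleSymbol N) := by
  have h : AEStronglyMeasurable (fun p : E3 × E3 => (dipole p.1 p.2 : ℂ) * N p.2)
      (volume.prod volume) :=
    (Complex.measurable_ofReal.comp measurable_dipole).aestronglyMeasurable.mul hN.comp_snd
  exact h.integral_prod_right'

/-- The Fourier integral operator with symbol `dipoleSymbol N` applied to the transform `Φ`. -/
def dipoleOp (N Φ : E3 → ℂ) (v : E3) : ℂ :=
  ∫ η, dipoleSymbol N η * Φ η * Complex.exp (Complex.I * (⟪v, η⟫ : ℝ))

lemma lintegral_enorm_dipoleOp_le {N Φ : E3 → ℂ} (hN : AEStronglyMeasurable N)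
    (hΦ : AEStronglyMeasurable Φ) (v : E3) :
    ∫⁻ η, ‖dipoleSymbol N η * Φ η * Complex.exp (Complex.I * (⟪v, η⟫ : ℝ))‖ₑ ≤
      dipoleConst * eLpNorm N 2 volume * ∫⁻ η, ENNReal.ofReal (2 + ‖η‖) * ‖Φ η‖ₑ := by
  have hm := hΦ.enorm
  rw [← lintegral_const_mul'' _ (by fun_prop)]
  refine lintegral_mono fun η => ?_
  have he : ‖Complex.exp (Complex.I * (⟪v, η⟫ : ℝ))‖ₑ = 1 := by
    rw [← ofReal_norm, mul_comm, Complex.norm_exp_ofReal_mul_I, ofReal_one]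
  rw [enorm_mul, enorm_mul, he, mul_one]
  exact (mul_le_mul' (enorm_dipoleSymbol_le hN η) le_rfl).trans_eq (by ring)

lemma aestronglyMeasurable_dipoleOp_integrand {N Φ : E3 → ℂ} (hN : AEStronglyMeasurable N)
    (hΦ : AEStronglyMeasurable Φ) :
    AEStronglyMeasurable (fun p : E3 × E3 =>
      dipoleSymbol N p.2 * Φ p.2 * Complex.exp (Complex.I * (⟪p.1, p.2⟫ : ℝ)))
      (volume.prod volume) := by
  refine ((aestronglyMeasurable_dipoleSymbol hN).mul hΦ).comp_snd.mul ?_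
  exact Continuous.aestronglyMeasurable (by fun_prop)

lemma aestronglyMeasurable_dipoleOp {N Φ : E3 → ℂ} (hN : AEStronglyMeasurable N)
    (hΦ : AEStronglyMeasurable Φ) : AEStronglyMeasurable (dipoleOp N Φ) :=
  (aestronglyMeasurable_dipoleOp_integrand hN hΦ).integral_prod_right'

lemma integrable_dipoleOp {N Φ : E3 → ℂ} (hN : MemLp N 2) (hΦ : AEStronglyMeasurable Φ)
    (hΦ' : ∫⁻ η, ENNReal.ofReal (2 + ‖η‖) * ‖Φ η‖ₑ ≠ ⊤) (v : E3) :
    Integrable fun η => dipoleSymbol N η * Φ η * Complex.exp (Complex.I * (⟪v, η⟫ : ℝ)) := by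
  refine ⟨((aestronglyMeasurable_dipoleSymbol hN.1).mul hΦ).mul
    (Continuous.aestronglyMeasurable (by fun_prop)),
    (lintegral_enorm_dipoleOp_le hN.1 hΦ v).trans_lt ?_⟩
  have := dipoleConst_ne_top
  have := hN.eLpNorm_ne_top
  finiteness

lemma enorm_dipoleOp_sub_le {N f Φ : E3 → ℂ} (hN : MemLp N 2) (hf : MemLp f 2)
    (hΦ : AEStronglyMeasurable Φ) (hΦ' : ∫⁻ η, ENNReal.ofReal (2 + ‖η‖) * ‖Φ η‖ₑ ≠ ⊤) (v : E3) :
    ‖dipoleOp N Φ v - dipoleOp f Φ v‖ₑ ≤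
      dipoleConst * eLpNorm (N - f) 2 volume * ∫⁻ η, ENNReal.ofReal (2 + ‖η‖) * ‖Φ η‖ₑ := by
  unfold dipoleOp
  rw [← integral_sub (integrable_dipoleOp hN hΦ hΦ' v) (integrable_dipoleOp hf hΦ hΦ' v)]
  refine le_trans ?_ (lintegral_enorm_dipoleOp_le (hN.sub hf).1 hΦ v)
  refine (enorm_integral_le_lintegral_enorm _).trans_eq ?_
  simp only [dipoleSymbol_sub hN hf, sub_mul]

/-- Schwartz functions are dense in `L²`. -/
lemma exists_schwartz_eLpNorm_sub_le {N : E3 → ℂ} (hN : MemLp N 2) {ε : ℝ} (hε : 0 < ε) :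
    ∃ f : 𝓢(E3, ℂ), eLpNorm (N - ⇑f) 2 volume ≤ ENNReal.ofReal ε := by
  obtain ⟨g, hg₁, hg₂, hg₃⟩ := hN.exist_eLpNorm_sub_le ENNReal.ofNat_ne_top one_le_two hε
  exact ⟨hg₁.toSchwartzMap hg₂, hg₃⟩

lemma exists_lintegral_dipoleOp_schwartz_le :
    ∃ K : ℝ≥0∞, K ≠ ⊤ ∧ ∀ φ : E3 → ℝ, ContDiff ℝ 1 φ → ∀ Φ : E3 → ℂ, Integrable Φ →
      (∀ w, ∫ η, Φ η * Complex.exp (Complex.I * (⟪w, η⟫ : ℝ)) =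
        (((2 * π : ℝ) ^ ((3:ℝ)/2) : ℝ) : ℂ) * φ w) →
      ∀ f : 𝓢(E3, ℂ), ∫⁻ v, (wt v * ‖dipoleOp f Φ v‖ₑ) ^ 2 ≤
        K * eLpNorm f 2 volume ^ 2 *
          ((∫⁻ v, (wt v * ‖φ v‖ₑ) ^ 2) + ∫⁻ v, (wt v * ‖fderiv ℝ φ v‖ₑ) ^ 2) := by
  obtain ⟨K, hK, hbound⟩ := exists_lintegral_weighted_difference_le
  set c : ℝ≥0∞ := ‖(2 * π : ℝ) ^ ((3:ℝ)/2)‖ₑ with hc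
  have hct : c ≠ ⊤ := enorm_ne_top
  have hE : ∀ r : ℝ, ‖(r : ℂ)‖ₑ = ‖r‖ₑ := fun r => by
    rw [← ofReal_norm, ← ofReal_norm, Complex.norm_real]
  refine ⟨c ^ 2 * K, by finiteness, fun φ hφ Φ hΦ hΦφ f => ?_⟩
  have hpt : ∀ v, wt v * ‖dipoleOp f Φ v‖ₑ ≤ c * ∫⁻ k, ‖𝓕 f k‖ₑ *
      (invSq k * (wt v * ‖φ (v + π • k) - φ (v + (-π) • k)‖ₑ)) := by
    intro v
    have h1 := integral_multiplier_schwartz f hΦ hΦφ v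
    have h2 : ‖dipoleOp f Φ v‖ₑ ≤ ‖(π : ℂ) * dipoleOp f Φ v‖ₑ := by
      rw [enorm_mul, hE, Real.enorm_of_nonneg pi_pos.le]
      refine le_mul_of_one_le_left' ?_
      rw [ENNReal.one_le_ofReal]
      linarith [pi_gt_three]
    calc wt v * ‖dipoleOp f Φ v‖ₑ ≤ wt v * ∫⁻ k, ‖(((‖k‖⁻¹ ^ 2 : ℝ) : ℂ) * 𝓕 f k) *
          ((((2 * π : ℝ) ^ ((3:ℝ)/2) : ℝ) : ℂ) * φ (v + π • k) -
            (((2 * π : ℝ) ^ ((3:ℝ)/2) : ℝ) : ℂ) * φ (v - π • k))‖ₑ := by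
          refine mul_le_mul' le_rfl (h2.trans ?_)
          rw [show (π : ℂ) * dipoleOp f Φ v = _ from h1]
          exact enorm_integral_le_lintegral_enorm _
      _ = _ := by
          rw [← lintegral_const_mul' _ _ (wt_ne_top v), ← lintegral_const_mul' _ _ hct]
          congr 1 with k
          rw [← mul_sub, ← Complex.ofReal_sub, enorm_mul, enorm_mul, enorm_mul, hE, hE, hE,
            ← hc, Real.enorm_of_nonneg (by positivity), invSq, neg_smul, ← sub_eq_add_neg]
          ring
  have hF : Measurable fun k => ‖𝓕 f k‖ₑ := (𝓕 f).continuous.enorm.measurable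
  have hb := hbound φ hφ _ hF
  rw [f.lintegral_fourier_sq, ← eLpNorm_two_sq] at hb
  calc _ ≤ ∫⁻ v, c ^ 2 * (∫⁻ k, ‖𝓕 f k‖ₑ *
      (invSq k * (wt v * ‖φ (v + π • k) - φ (v + (-π) • k)‖ₑ))) ^ 2 := by
        refine lintegral_mono fun v => ?_
        rw [← mul_pow]
        exact pow_le_pow_left' (hpt v) 2
    _ ≤ c ^ 2 * (K * eLpNorm f 2 volume ^ 2 *
          ((∫⁻ v, (wt v * ‖φ v‖ₑ) ^ 2) + ∫⁻ v, (wt v * ‖fderiv ℝ φ v‖ₑ) ^ 2)) := by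
        rw [lintegral_const_mul' _ _ (by finiteness)]
        exact mul_le_mul' le_rfl hb
    _ = _ := by ring

lemma exists_lintegral_dipoleOp_le :
    ∃ K : ℝ≥0∞, K ≠ ⊤ ∧ ∀ φ : E3 → ℝ, ContDiff ℝ 1 φ → ∀ Φ : E3 → ℂ, Integrable Φ →
      ∫⁻ η, ENNReal.ofReal (2 + ‖η‖) * ‖Φ η‖ₑ ≠ ⊤ →
      (∀ w, ∫ η, Φ η * Complex.exp (Complex.I * (⟪w, η⟫ : ℝ)) =
        (((2 * π : ℝ) ^ ((3:ℝ)/2) : ℝ) : ℂ) * φ w) →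
      ∀ N : E3 → ℂ, MemLp N 2 → ∫⁻ v, (wt v * ‖dipoleOp N Φ v‖ₑ) ^ 2 ≤
        K * eLpNorm N 2 volume ^ 2 *
          ((∫⁻ v, (wt v * ‖φ v‖ₑ) ^ 2) + ∫⁻ v, (wt v * ‖fderiv ℝ φ v‖ₑ) ^ 2) := by
  obtain ⟨K, hK, hbound⟩ := exists_lintegral_dipoleOp_schwartz_le
  refine ⟨K + 1, by finiteness, fun φ hφ Φ hΦ hΦ' hΦφ N hN => ?_⟩
  set R := (∫⁻ v, (wt v * ‖φ v‖ₑ) ^ 2) + ∫⁻ v, (wt v * ‖fderiv ℝ φ v‖ₑ) ^ 2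
  rcases eq_or_ne (eLpNorm N 2 volume) 0 with hN0 | hN0
  · have h0 : ∀ v, ‖dipoleOp N Φ v‖ₑ = 0 := fun v => by
      refine le_antisymm ?_ zero_le
      refine (enorm_integral_le_lintegral_enorm _).trans
        ((lintegral_enorm_dipoleOp_le hN.1 hΦ.1 v).trans_eq ?_)
      rw [hN0, mul_zero, zero_mul]
    simp [h0]
  rcases eq_or_ne R ⊤ with hR | hR
  · rw [hR, ENNReal.mul_top (mul_ne_zero (by simp) (pow_ne_zero 2 hN0))]
    exact le_top
  refine le_trans ?_ (mul_le_mul' (mul_le_mul' (le_self_add (a := K) (b := 1)) le_rfl) le_rfl)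
  choose f hf using fun j : ℕ =>
    exists_schwartz_eLpNorm_sub_le hN (Nat.one_div_pos_of_nat (α := ℝ) (n := j))
  have hε : Tendsto (fun j : ℕ => ENNReal.ofReal (1 / ((j : ℝ) + 1))) atTop (nhds 0) := by
    simpa using ENNReal.tendsto_ofReal tendsto_one_div_add_atTop_nhds_zero_nat
  have hsub : Tendsto (fun j => eLpNorm (N - ⇑(f j)) 2 volume) atTop (nhds 0) :=
    tendsto_of_tendsto_of_tendsto_of_le_of_le tendsto_const_nhds hε (fun _ => zero_le) hf
  have hnorm : ∀ j, eLpNorm (f j) 2 volume ≤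
      eLpNorm N 2 volume + eLpNorm (N - ⇑(f j)) 2 volume := fun j => by
    have h := eLpNorm_sub_le hN.1 (hN.sub ((f j).memLp 2)).1 one_le_two
    rwa [show N - (N - ⇑(f j)) = ⇑(f j) by ext; simp] at h
  have hlimR : Tendsto (fun j => K * (eLpNorm N 2 volume + eLpNorm (N - ⇑(f j)) 2 volume) ^ 2 * R)
      atTop (nhds (K * eLpNorm N 2 volume ^ 2 * R)) := by
    have h1 : Tendsto (fun j => eLpNorm N 2 volume + eLpNorm (N - ⇑(f j)) 2 volume) atTop
        (nhds (eLpNorm N 2 volume)) := by simpa using tendsto_const_nhds.add hsub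
    exact ENNReal.Tendsto.mul_const (ENNReal.Tendsto.const_mul (ENNReal.Tendsto.pow h1)
      (Or.inr hK)) (Or.inr hR)
  have hlim : ∀ v, Tendsto (fun j => (wt v * ‖dipoleOp (f j) Φ v‖ₑ) ^ 2) atTop
      (nhds ((wt v * ‖dipoleOp N Φ v‖ₑ) ^ 2)) := by
    intro v
    have h1 : Tendsto (fun j => dipoleOp (f j) Φ v) atTop (nhds (dipoleOp N Φ v)) := by
      rw [tendsto_iff_edist_tendsto_0]
      refine tendsto_of_tendsto_of_tendsto_of_le_of_le tendsto_const_nhds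
        (h := fun j => dipoleConst * eLpNorm (N - ⇑(f j)) 2 volume *
          ∫⁻ η, ENNReal.ofReal (2 + ‖η‖) * ‖Φ η‖ₑ) ?_ (fun _ => zero_le) (fun j => ?_)
      · have := ENNReal.Tendsto.mul_const (ENNReal.Tendsto.const_mul hsub
          (Or.inr dipoleConst_ne_top)) (Or.inr hΦ')
        simpa using this
      · rw [edist_comm, edist_eq_enorm_sub]
        exact enorm_dipoleOp_sub_le hN ((f j).memLp 2) hΦ.1 hΦ' v
    exact ENNReal.Tendsto.pow (ENNReal.Tendsto.const_mul h1.enorm (Or.inr (wt_ne_top v)))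
  have hm : ∀ j, AEMeasurable (fun v => (wt v * ‖dipoleOp (f j) Φ v‖ₑ) ^ 2) := fun j =>
    (measurable_wt.aemeasurable.mul
      (aestronglyMeasurable_dipoleOp (f j).continuous.aestronglyMeasurable hΦ.1).enorm).pow_const 2
  calc ∫⁻ v, (wt v * ‖dipoleOp N Φ v‖ₑ) ^ 2
      = ∫⁻ v, liminf (fun j => (wt v * ‖dipoleOp (f j) Φ v‖ₑ) ^ 2) atTop := by
        simp only [(hlim _).liminf_eq]
    _ ≤ liminf (fun j => ∫⁻ v, (wt v * ‖dipoleOp (f j) Φ v‖ₑ) ^ 2) atTop :=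
        lintegral_liminf_le' hm
    _ ≤ liminf (fun j => K * (eLpNorm N 2 volume + eLpNorm (N - ⇑(f j)) 2 volume) ^ 2 * R) atTop :=
        liminf_le_liminf (Eventually.of_forall fun j => (hbound φ hφ Φ hΦ hΦφ (f j)).trans
          (mul_le_mul' (mul_le_mul' le_rfl (pow_le_pow_left' (hnorm j) 2)) le_rfl))
    _ = _ := hlimR.liminf_eq

lemma enorm_complex_ofReal (r : ℝ) : ‖(r : ℂ)‖ₑ = ‖r‖ₑ := by
  rw [← ofReal_norm, ← ofReal_norm, Complex.norm_real]

lemma enorm_sq_mul_weight {F : Type*} [NormedAddCommGroup F] (a : F) (v : E3) :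
    (‖a‖₊ : ℝ≥0∞) ^ 2 * ENNReal.ofReal ((1 + ‖v‖ ^ 2) ^ 2) = (wt v * ‖a‖ₑ) ^ 2 := by
  rw [wt, mul_pow, ENNReal.ofReal_pow (by positivity), mul_comm]; rfl

lemma ENNReal.rpow_half_sq (a : ℝ≥0∞) : (a ^ (1 / 2 : ℝ)) ^ 2 = a := by
  rw [← ENNReal.rpow_natCast, ← ENNReal.rpow_mul]; norm_num

lemma Xnorm_sq {w : E3 × E3 → ℝ} (hw : Measurable w) :
    Xnorm w ^ 2 = ∫⁻ x, ∫⁻ v, (wt v * ‖w (x, v)‖ₑ) ^ 2 := by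
  have hm := measurable_wt
  simp only [Xnorm, ENNReal.rpow_half_sq, enorm_sq_mul_weight]
  exact lintegral_prod _ (by fun_prop)

lemma XnormC_sq_le (w : E3 × E3 → ℂ) :
    XnormC w ^ 2 ≤ ∫⁻ x, ∫⁻ v, (wt v * ‖w (x, v)‖ₑ) ^ 2 := by
  simp only [XnormC, ENNReal.rpow_half_sq, enorm_sq_mul_weight]
  exact lintegral_prod_le _

lemma opNorm_comp_inr_sq_le (A : E3 × E3 →L[ℝ] ℝ) :
    ‖A.comp (ContinuousLinearMap.inr ℝ E3 E3)‖ ^ 2 ≤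
      ∑ i : Fin 3, (A (0, EuclideanSpace.single i 1)) ^ 2 := by
  set S := ∑ i : Fin 3, (A (0, EuclideanSpace.single i 1)) ^ 2
  have hS : 0 ≤ S := Finset.sum_nonneg fun i _ => sq_nonneg _
  have h : ‖A.comp (ContinuousLinearMap.inr ℝ E3 E3)‖ ≤ √S := by
    refine ContinuousLinearMap.opNorm_le_bound _ (sqrt_nonneg _) fun w => ?_
    have hw : w = ∑ i : Fin 3, w i • EuclideanSpace.single i (1:ℝ) := by
      ext j; fin_cases j <;> simp [Fin.sum_univ_three]
    have h1 : A.comp (ContinuousLinearMap.inr ℝ E3 E3) w =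
        ∑ i : Fin 3, A (0, EuclideanSpace.single i 1) * w i := by
      conv_lhs => rw [hw]
      simp [mul_comm]
    rw [Real.norm_eq_abs, h1]
    refine abs_le_of_sq_le_sq ?_ (by positivity)
    rw [mul_pow, sq_sqrt hS, EuclideanSpace.norm_sq_eq]
    simpa using Finset.sum_mul_sq_le_sq_mul_sq Finset.univ
      (fun i => A (0, EuclideanSpace.single i 1)) (fun i => w i)
  calc _ ≤ √S ^ 2 := by gcongr
    _ = S := sq_sqrt hS

lemma XnormGradV_sq_ge {u : E3 × E3 → ℝ} (hu : ContDiff ℝ 1 u) :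
    ∫⁻ x, ∫⁻ v, (wt v * ‖fderiv ℝ (fun v => u (x, v)) v‖ₑ) ^ 2 ≤ XnormGradV u ^ 2 := by
  have hc := hu.continuous_fderiv one_ne_zero
  have hm : Measurable fun p : E3 × E3 => ENNReal.ofReal
      ((∑ i : Fin 3, (fderiv ℝ u p (0, EuclideanSpace.single i 1)) ^ 2) *
        (1 + ‖p.2‖ ^ 2) ^ 2) := by
    refine Continuous.measurable (ENNReal.continuous_ofReal.comp ?_)
    fun_prop
  rw [XnormGradV, ENNReal.rpow_half_sq, Measure.volume_eq_prod, lintegral_prod _ hm.aemeasurable]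
  refine lintegral_mono fun x => lintegral_mono fun v => ?_
  have hd : fderiv ℝ (fun v => u (x, v)) v =
      (fderiv ℝ u (x, v)).comp (ContinuousLinearMap.inr ℝ E3 E3) :=
    (((hu.differentiable one_ne_zero (x, v)).hasFDerivAt).comp v
      (hasFDerivAt_prodMk_right x v)).fderiv
  rw [hd, wt, ← ofReal_norm, ← ENNReal.ofReal_mul (by positivity),
    ← ENNReal.ofReal_pow (by positivity), mul_pow, mul_comm]
  exact ENNReal.ofReal_le_ofReal (mul_le_mul_of_nonneg_right (opNorm_comp_inr_sq_le _)
    (by positivity))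

lemma hasTemperateGrowth_prodMk (x : E3) :
    (fun v : E3 => (x, v)).HasTemperateGrowth := by
  have h := (Function.HasTemperateGrowth.const (E := E3) ((x, 0) : E3 × E3)).add
    (ContinuousLinearMap.inr ℝ E3 E3).hasTemperateGrowth
  convert h using 1
  ext1 v
  simp

/-- The restriction of a Schwartz function to the fibre over `x`, with complex values. -/
def SchwartzMap.fiber (u : 𝓢(E3 × E3, ℝ)) (x : E3) : 𝓢(E3, ℂ) :=
  postcompCLM Complex.ofRealCLM (compCLMOfAntilipschitz ℝ (K := 1) (g := fun v : E3 => (x, v))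
    (hasTemperateGrowth_prodMk x)
    (AntilipschitzWith.of_le_mul_dist fun v w => by simp [Prod.dist_eq]) u)

lemma SchwartzMap.fiber_apply (u : 𝓢(E3 × E3, ℝ)) (x v : E3) : u.fiber x v = u (x, v) := rfl

lemma lintegral_fourierV_ne_top (u : 𝓢(E3 × E3, ℝ)) (x : E3) :
    ∫⁻ η, ENNReal.ofReal (2 + ‖η‖) * ‖fourierV u x η‖ₑ ≠ ⊤ := by
  set f : 𝓢(E3, ℂ) := 𝓕 (u.fiber x)
  set c : ℂ := (((2 * π : ℝ) ^ (-(3:ℝ)/2) : ℝ) : ℂ)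
  have hi : Integrable fun ξ => (2 + 2 * π * ‖ξ‖) * (‖c‖ * ‖f ξ‖) := by
    have h1 := (f.integrable_pow_mul volume 1).const_mul (2 * π * ‖c‖)
    have h0 := (f.integrable (μ := volume)).norm.const_mul (2 * ‖c‖)
    refine (h0.add h1).congr (ae_of_all _ fun ξ => ?_)
    simp only [Pi.add_apply, pow_one]
    ring
  have h2 := (hi.comp_smul (R := (2 * π)⁻¹) (by positivity)).lintegral_lt_top
  refine (lt_of_eq_of_lt ?_ h2).ne
  congr 1 with η
  rw [fourierV_eq (u.fiber_apply x), ← ofReal_norm, ← ENNReal.ofReal_mul (by positivity),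
    norm_mul, norm_smul, norm_inv, Real.norm_of_nonneg (by positivity : 0 ≤ 2 * π),
    mul_inv_cancel_left₀ (by positivity)]

/-- The density seen from `x`, as a complex valued function. -/
def densAt (z : E3 × E3 → ℝ) (x y : E3) : ℂ := (dens z (x - y) : ℂ)

lemma measurable_dens {z : E3 × E3 → ℝ} (hz : Measurable z) : Measurable (dens z) :=
  hz.stronglyMeasurable.integral_prod_right'.measurable

lemma eLpNorm_densAt_sq_le {z : E3 × E3 → ℝ} (hz : Measurable z) (x : E3) :
    eLpNorm (densAt z x) 2 volume ^ 2 ≤ (∫⁻ v, (wt v)⁻¹ ^ 2) * Xnorm z ^ 2 := by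
  rw [eLpNorm_two_sq, Xnorm_sq hz]
  simp only [densAt, enorm_complex_ofReal]
  rw [lintegral_sub_left_eq_self (fun y => ‖dens z y‖ₑ ^ 2) x,
    ← lintegral_const_mul' _ _ lintegral_wt_inv_lt_top.ne]
  refine lintegral_mono fun y => ?_
  refine (pow_le_pow_left' (enorm_integral_le_lintegral_enorm _) 2).trans ?_
  exact lintegral_enorm_sq_le (hz.comp measurable_prodMk_left)

lemma memLp_densAt {z : E3 × E3 → ℝ} (hz : Measurable z) (hz' : Xnorm z < ⊤) (x : E3) :
    MemLp (densAt z x) 2 := by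
  have hd := measurable_dens hz
  refine ⟨(Complex.measurable_ofReal.comp
    (hd.comp (measurable_const.sub measurable_id))).aestronglyMeasurable, ?_⟩
  have h1 := lintegral_wt_inv_lt_top.ne
  have h := (eLpNorm_densAt_sq_le hz x).trans_lt (by finiteness)
  exact (ENNReal.pow_lt_top_iff.1 h).resolve_right two_ne_zero

lemma Theta_eq (z u : E3 × E3 → ℝ) (x v : E3) :
    Theta z u x v = Complex.I * (((2 * π : ℝ) ^ (-(3:ℝ)/2) * (4 * π)⁻¹ : ℝ) : ℂ) *
      dipoleOp (densAt z x) (fourierV u x) v := by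
  have hδ : ∀ η, (deltaV z x η : ℂ) = (((4 * π)⁻¹ : ℝ) : ℂ) * dipoleSymbol (densAt z x) η := by
    intro η
    rw [deltaV, dipoleSymbol, Complex.ofReal_mul, ← integral_complex_ofReal]
    simp only [densAt, dipole, Complex.ofReal_mul]
  rw [Theta, dipoleOp, ← integral_const_mul, ← integral_const_mul]
  congr 1 with η
  rw [hδ, Complex.ofReal_mul]
  ring

end

/-- Prop. 2.5: boundedness of the nonlinear term,
`‖Θ[V[z]]u‖_X ≤ C (‖u‖_X + ‖∇_v u‖_X) ‖z‖_X`. -/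
theorem theta_bound :
    ∃ C : ℝ, 0 < C ∧
      ∀ z : E3 × E3 → ℝ, Measurable z → Xnorm z < ⊤ →
        ∀ u : SchwartzMap (E3 × E3) ℝ,
          XnormC (fun p : E3 × E3 => Theta z (⇑u) p.1 p.2) ≤
            ENNReal.ofReal C * (Xnorm (⇑u) + XnormGradV (⇑u)) * Xnorm z := by
  obtain ⟨K, hK, hbound⟩ := exists_lintegral_dipoleOp_le
  set W := ∫⁻ v, (wt v)⁻¹ ^ 2
  have hW : W ≠ ⊤ := lintegral_wt_inv_lt_top.ne
  set c : ℝ≥0∞ := ‖(2 * π : ℝ) ^ (-(3:ℝ)/2) * (4 * π)⁻¹‖ₑ with hc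
  have hct : c ≠ ⊤ := enorm_ne_top
  set M : ℝ≥0∞ := 1 + c ^ 2 * (K * W)
  have hM : M ≠ ⊤ := by finiteness
  refine ⟨M.toReal, ENNReal.toReal_pos (by simp [M]) hM, fun z hz hz' u => ?_⟩
  rw [ENNReal.ofReal_toReal hM]
  have hu : ContDiff ℝ 1 u := u.smooth 1
  refine (ENNReal.pow_le_pow_left_iff two_ne_zero).1 ?_
  have hfib : ∀ x, ∫⁻ v, (wt v * ‖Theta z u x v‖ₑ) ^ 2 ≤ c ^ 2 * (K * (W * Xnorm z ^ 2) *
      ((∫⁻ v, (wt v * ‖u (x, v)‖ₑ) ^ 2) +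
        ∫⁻ v, (wt v * ‖fderiv ℝ (fun v => u (x, v)) v‖ₑ) ^ 2)) := by
    intro x
    have hux : ContDiff ℝ 1 fun v => u (x, v) := by fun_prop
    have hb := hbound (fun v => u (x, v)) hux (fourierV u x)
      (integrable_fourierV (u.fiber_apply x)) (lintegral_fourierV_ne_top u x)
      (fun w => integral_fourierV_mul_exp (u.fiber_apply x) w) _ (memLp_densAt hz hz' x)
    have he : ∀ v, (wt v * ‖Theta z u x v‖ₑ) ^ 2 =
        c ^ 2 * (wt v * ‖dipoleOp (densAt z x) (fourierV u x) v‖ₑ) ^ 2 := by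
      intro v
      have hI : ‖Complex.I‖ₑ = 1 := by rw [← ofReal_norm]; simp
      rw [Theta_eq, enorm_mul, enorm_mul, enorm_complex_ofReal, hI, ← hc]
      ring
    simp only [he]
    rw [lintegral_const_mul' _ _ (by finiteness)]
    exact mul_le_mul' le_rfl (hb.trans (mul_le_mul' (mul_le_mul' le_rfl
      (eLpNorm_densAt_sq_le hz x)) le_rfl))
  have hwt := measurable_wt
  have hum : Measurable fun p : E3 × E3 => (wt p.2 * ‖u p‖ₑ) ^ 2 := by
    have := u.continuous.measurable
    fun_prop
  calc XnormC (fun p : E3 × E3 => Theta z u p.1 p.2) ^ 2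
      ≤ ∫⁻ x, ∫⁻ v, (wt v * ‖Theta z u x v‖ₑ) ^ 2 := XnormC_sq_le _
    _ ≤ ∫⁻ x, c ^ 2 * (K * (W * Xnorm z ^ 2)) * ((∫⁻ v, (wt v * ‖u (x, v)‖ₑ) ^ 2) +
          ∫⁻ v, (wt v * ‖fderiv ℝ (fun v => u (x, v)) v‖ₑ) ^ 2) :=
        lintegral_mono fun x => (hfib x).trans_eq (by simp only [mul_assoc])
    _ = c ^ 2 * (K * (W * Xnorm z ^ 2)) * (Xnorm u ^ 2 +
          ∫⁻ x, ∫⁻ v, (wt v * ‖fderiv ℝ (fun v => u (x, v)) v‖ₑ) ^ 2) := by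
        rw [lintegral_const_mul' _ _ (by finiteness),
          lintegral_add_left hum.lintegral_prod_right', Xnorm_sq u.continuous.measurable]
    _ ≤ c ^ 2 * (K * (W * Xnorm z ^ 2)) * (Xnorm u ^ 2 + XnormGradV u ^ 2) :=
        mul_le_mul' le_rfl (add_le_add le_rfl (XnormGradV_sq_ge hu))
    _ = c ^ 2 * (K * W) * (Xnorm u ^ 2 + XnormGradV u ^ 2) * Xnorm z ^ 2 := by ring
    _ ≤ M ^ 2 * (Xnorm u + XnormGradV u) ^ 2 * Xnorm z ^ 2 := by
        refine mul_le_mul' (mul_le_mul' ?_ ?_) le_rfl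
        · rw [pow_two M]
          exact le_add_self.trans (le_mul_of_one_le_left' le_self_add)
        · rw [add_sq']
          exact le_self_add
    _ = (M * (Xnorm u + XnormGradV u) * Xnorm z) ^ 2 := by ring

end
end

section
/- For every Schwartz function u on ℝ³×ℝ³ and every s > 0: ∫_{−1/2}^{1/2} ∫_{ℝ³}∫_{ℝ³} | (2π)^{-3/2} ∫_{ℝ³} u(x − v, v/s − r z) e^{-i v·z} dv |² dx dz dr = s³ ∫_{ℝ³}∫_{ℝ³} |u(x,v)|² dx dv. In other words, ∫_{−1/2}^{1/2} ‖ F_{v→z}( (x,v) ↦ u(x−v, v/s − r z) ) ‖²_{L²(ℝ³_x×ℝ³_z)} dr = s³ ‖u‖²_{L²(ℝ⁶)}. -/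
open MeasureTheory Real Filter ENNReal RealInnerProductSpace

noncomputable section

section

variable {E : Type*} [NormedAddCommGroup E] [InnerProductSpace ℝ E]

/-- The restriction of a Schwartz function to the affine graph `{(y - s w, w)}`, as a
complex-valued Schwartz function of `w`. -/
def graphSlice (u : SchwartzMap (E × E) ℝ) (s : ℝ) (y : E) : SchwartzMap E ℂ :=
  (SchwartzMap.compCLM ℝ (g := fun w : E => (y - s • w, w))
    (by
      convert (Function.HasTemperateGrowth.const (y, (0 : E))).add
        ((-s • ContinuousLinearMap.id ℝ E).prod (ContinuousLinearMap.id ℝ E)).hasTemperateGrowth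
        using 1
      ext w <;> simp [sub_eq_add_neg])
    ⟨1, 1, fun w => by
      have := norm_snd_le (y - s • w, w)
      simp only [pow_one, one_mul] at *
      linarith⟩ u).postcompCLM Complex.ofRealCLM

@[simp] lemma graphSlice_apply (u : SchwartzMap (E × E) ℝ) (s : ℝ) (y w : E) :
    graphSlice u s y w = (u (y - s • w, w) : ℂ) := rfl

variable [FiniteDimensional ℝ E] [MeasurableSpace E] [BorelSpace E]

lemma integral_mul_exp_eq_fourier (f : SchwartzMap E ℂ) (s : ℝ) (z : E) :
    ∫ w : E, f w * Complex.exp (-(Complex.I) * ((⟪s • w, z⟫ : ℝ) : ℂ)) =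
      FourierTransform.fourier f ((s / (2 * π)) • z) := by
  rw [SchwartzMap.fourier_coe, Real.fourier_eq']
  congr 1
  ext w
  rw [smul_eq_mul, mul_comm]
  congr 2
  have hπ : (π : ℂ) ≠ 0 := by exact_mod_cast Real.pi_ne_zero
  simp only [real_inner_smul_left, real_inner_smul_right]
  push_cast
  field_simp

lemma integrable_norm_sq (f : SchwartzMap E ℂ) : Integrable fun w : E => ‖f w‖ ^ 2 :=
  (memLp_two_iff_integrable_sq_norm f.continuous.aestronglyMeasurable).1 (f.memLp 2)

lemma integrable_norm_sq_integral_mul_exp (f : SchwartzMap E ℂ) {s : ℝ} (hs : 0 < s) :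
    Integrable fun z : E =>
      ‖∫ w : E, f w * Complex.exp (-(Complex.I) * ((⟪s • w, z⟫ : ℝ) : ℂ))‖ ^ 2 := by
  simp_rw [integral_mul_exp_eq_fourier]
  exact (integrable_norm_sq (FourierTransform.fourier f)).comp_smul (by positivity)

lemma integral_norm_sq_integral_mul_exp (f : SchwartzMap E ℂ) {s : ℝ} (hs : 0 < s) :
    ∫ z : E, ‖∫ w : E, f w * Complex.exp (-(Complex.I) * ((⟪s • w, z⟫ : ℝ) : ℂ))‖ ^ 2 =
      (2 * π / s) ^ Module.finrank ℝ E * ∫ w : E, ‖f w‖ ^ 2 := by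
  simp_rw [integral_mul_exp_eq_fourier]
  rw [Measure.integral_comp_smul_of_nonneg volume
    (fun z => ‖FourierTransform.fourier f z‖ ^ 2) _ (hR := by positivity),
    SchwartzMap.integral_norm_sq_fourier, smul_eq_mul, ← inv_pow, inv_div]

lemma measurePreserving_sub_smul (a : ℝ) :
    MeasurePreserving (fun p : E × E => (p.1 - a • p.2, p.2)) := by
  have h : MeasurePreserving (fun p : E × E => (p.1, p.2 - a • p.1)) :=
    (MeasurePreserving.id (volume : Measure E)).skew_product
      (g := fun x y => y - a • x) (by fun_prop)
      (Eventually.of_forall fun x => (measurePreserving_sub_right volume (a • x)).map_eq)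
  exact (Measure.measurePreserving_swap.comp h).comp Measure.measurePreserving_swap

lemma integral_comp_sub_smul {F : E × E → ℝ} (hF : AEStronglyMeasurable F) (a : ℝ) :
    ∫ p : E × E, F (p.1 - a • p.2, p.2) = ∫ p, F p := by
  have h := measurePreserving_sub_smul (E := E) a
  conv_rhs => rw [← h.map_eq]
  rw [integral_map h.measurable.aemeasurable (by rwa [h.map_eq])]

/-- The Fourier transform of `w ↦ u (y - s w, w)` at frequency `s z`. -/
def slicedFourier (u : SchwartzMap (E × E) ℝ) (s : ℝ) (p : E × E) : ℂ :=
  ∫ w : E, (u (p.1 - s • w, w) : ℂ) * Complex.exp (-(Complex.I) * ((⟪s • w, p.2⟫ : ℝ) : ℂ))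

lemma stronglyMeasurable_slicedFourier (u : SchwartzMap (E × E) ℝ) (s : ℝ) :
    StronglyMeasurable (slicedFourier u s) := by
  have hu := u.continuous
  refine StronglyMeasurable.integral_prod_right (f := fun (p : E × E) (w : E) =>
    (u (p.1 - s • w, w) : ℂ) * Complex.exp (-(Complex.I) * ((⟪s • w, p.2⟫ : ℝ) : ℂ))) ?_
  exact Continuous.stronglyMeasurable (by unfold Function.uncurry; fun_prop)

lemma integrable_sq (u : SchwartzMap (E × E) ℝ) : Integrable fun p : E × E => u p ^ 2 :=
  (memLp_two_iff_integrable_sq u.continuous.aestronglyMeasurable).1 <| by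
    have : (volume : Measure (E × E)).IsAddHaarMeasure :=
      inferInstanceAs (volume.prod volume).IsAddHaarMeasure
    exact u.memLp 2

lemma integral_norm_sq_slicedFourier_right (u : SchwartzMap (E × E) ℝ) {s : ℝ} (hs : 0 < s)
    (y : E) : ∫ z : E, ‖slicedFourier u s (y, z)‖ ^ 2 =
      (2 * π / s) ^ Module.finrank ℝ E * ∫ w : E, u (y - s • w, w) ^ 2 := by
  simpa [slicedFourier] using integral_norm_sq_integral_mul_exp (graphSlice u s y) hs

lemma integrable_sq_comp_sub_smul (u : SchwartzMap (E × E) ℝ) (s : ℝ) :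
    Integrable fun p : E × E => u (p.1 - s • p.2, p.2) ^ 2 :=
  (measurePreserving_sub_smul s).integrable_comp_of_integrable (integrable_sq u)

lemma integrable_norm_sq_slicedFourier (u : SchwartzMap (E × E) ℝ) {s : ℝ} (hs : 0 < s) :
    Integrable fun p : E × E => ‖slicedFourier u s p‖ ^ 2 := by
  refine (integrable_prod_iff
    ((stronglyMeasurable_slicedFourier u s).norm.pow 2).aestronglyMeasurable).2
    ⟨Eventually.of_forall fun y => ?_, ?_⟩
  · simpa [slicedFourier] using integrable_norm_sq_integral_mul_exp (graphSlice u s y) hs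
  · simp only [Pi.pow_apply, norm_pow, norm_norm, integral_norm_sq_slicedFourier_right u hs]
    exact (integrable_sq_comp_sub_smul u s).integral_prod_left.const_mul _

lemma integral_norm_sq_slicedFourier (u : SchwartzMap (E × E) ℝ) {s : ℝ} (hs : 0 < s) :
    ∫ p : E × E, ‖slicedFourier u s p‖ ^ 2 =
      (2 * π / s) ^ Module.finrank ℝ E * ∫ p : E × E, u p ^ 2 := by
  rw [Measure.volume_eq_prod, integral_prod _ (integrable_norm_sq_slicedFourier u hs)]
  simp_rw [integral_norm_sq_slicedFourier_right u hs]
  rw [integral_const_mul, ← integral_prod _ (integrable_sq_comp_sub_smul u s),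
    ← Measure.volume_eq_prod,
    integral_comp_sub_smul (integrable_sq u).aestronglyMeasurable]

lemma norm_integral_shifted (u : SchwartzMap (E × E) ℝ) {s : ℝ} (hs : 0 < s) (r : ℝ) (x z : E) :
    ‖∫ v : E, (u (x - v, s⁻¹ • v - r • z) : ℂ) *
        Complex.exp (-(Complex.I) * ((⟪v, z⟫ : ℝ) : ℂ))‖ =
      s ^ Module.finrank ℝ E * ‖slicedFourier u s (x - (s * r) • z, z)‖ := by
  set G : E → ℂ := fun v => (u (x - v, s⁻¹ • v - r • z) : ℂ) *
    Complex.exp (-(Complex.I) * ((⟪v, z⟫ : ℝ) : ℂ)) with hG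
  have hscale : ∫ v, G v = (s ^ Module.finrank ℝ E : ℝ) • ∫ w, G (s • (w + r • z)) := by
    rw [integral_add_right_eq_self (fun w => G (s • w)),
      Measure.integral_comp_smul_of_nonneg volume G s (hR := hs.le), smul_smul,
      mul_inv_cancel₀ (by positivity), one_smul]
  have hphase (w : E) : G (s • (w + r • z)) =
      Complex.exp (((-(s * r * ⟪z, z⟫) : ℝ) : ℂ) * Complex.I) *
        ((u (x - (s * r) • z - s • w, w) : ℂ) *
          Complex.exp (-(Complex.I) * ((⟪s • w, z⟫ : ℝ) : ℂ))) := by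
    have h₁ : x - s • (w + r • z) = x - (s * r) • z - s • w := by module
    have h₂ : s⁻¹ • s • (w + r • z) - r • z = w := by
      rw [inv_smul_smul₀ hs.ne', add_sub_cancel_right]
    simp only [hG, h₁, h₂]
    rw [mul_left_comm, ← Complex.exp_add]
    congr 2
    simp only [smul_add, inner_add_left, real_inner_smul_left]
    push_cast
    ring
  rw [hscale]
  simp_rw [hphase]
  rw [integral_const_mul, norm_smul, norm_mul, Complex.norm_exp_ofReal_mul_I, one_mul,
    Real.norm_of_nonneg (by positivity)]
  rfl

lemma integral_norm_sq_integral_shifted (u : SchwartzMap (E × E) ℝ) {s : ℝ} (hs : 0 < s) (r : ℝ) :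
    ∫ x : E, ∫ z : E, ‖∫ v : E, (u (x - v, s⁻¹ • v - r • z) : ℂ) *
        Complex.exp (-(Complex.I) * ((⟪v, z⟫ : ℝ) : ℂ))‖ ^ 2 =
      (2 * π * s) ^ Module.finrank ℝ E * ∫ p : E × E, u p ^ 2 := by
  have hi := integrable_norm_sq_slicedFourier u hs
  have hi' : Integrable fun p : E × E => ‖slicedFourier u s (p.1 - (s * r) • p.2, p.2)‖ ^ 2 :=
    (measurePreserving_sub_smul (s * r)).integrable_comp_of_integrable hi
  simp_rw [norm_integral_shifted u hs, mul_pow _ _ 2, integral_const_mul]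
  rw [← integral_prod _ hi', ← Measure.volume_eq_prod,
    integral_comp_sub_smul (F := fun p => ‖slicedFourier u s p‖ ^ 2) hi.aestronglyMeasurable,
    integral_norm_sq_slicedFourier u hs, ← mul_assoc, ← pow_mul, mul_comm _ 2, pow_mul, ← mul_pow]
  congr 2
  field_simp

end

/-- The Plancherel-type identity
`∫_{−1/2}^{1/2} ‖F_{v→z}((x,v) ↦ u(x−v, v/s − r z))‖²_{L²_{x,z}} dr = s³ ‖u‖²_{L²}`. -/
theorem shifted_fourier_identity (u : SchwartzMap (E3 × E3) ℝ) (s : ℝ) (hs : 0 < s) :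
    (∫ r in (-(1/2) : ℝ)..(1/2 : ℝ), ∫ x : E3, ∫ z : E3,
        ‖((2 * π : ℝ) ^ (-(3:ℝ)/2) : ℝ) *
            ∫ v : E3, (u (x - v, s⁻¹ • v - r • z) : ℂ) *
              Complex.exp (-(Complex.I) * ((⟪v, z⟫ : ℝ) : ℂ))‖ ^ 2) =
      s ^ 3 * ∫ p : E3 × E3, (u p) ^ 2 := by
  have hc : (((2 * π : ℝ) ^ (-(3:ℝ)/2)) ^ 2 : ℝ) = ((2 * π) ^ 3)⁻¹ := by
    rw [← Real.rpow_natCast, ← Real.rpow_mul (by positivity), ← Real.rpow_natCast (2 * π) 3,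
      ← Real.rpow_neg (by positivity)]
    norm_num
  have hr (r : ℝ) : (∫ x : E3, ∫ z : E3, ‖((2 * π : ℝ) ^ (-(3:ℝ)/2) : ℝ) *
      ∫ v : E3, (u (x - v, s⁻¹ • v - r • z) : ℂ) *
        Complex.exp (-(Complex.I) * ((⟪v, z⟫ : ℝ) : ℂ))‖ ^ 2) =
      s ^ 3 * ∫ p : E3 × E3, (u p) ^ 2 := by
    simp_rw [norm_mul, mul_pow, Complex.norm_real, Real.norm_eq_abs, sq_abs, hc,
      integral_const_mul]
    rw [integral_norm_sq_integral_shifted u hs r, finrank_euclideanSpace_fin, mul_pow]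
    field_simp
  simp_rw [hr]
  rw [intervalIntegral.integral_const]
  norm_num

end
end
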